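/- Let Ω ⊆ ℝⁿ be a bounded domain, p ≥ 1 for n = 2 and p > n−1 for n ≥ 3. Let f_k, f : Ω → ℝⁿ be homeomorphisms onto their images with f_k → f in W^{1,p}_loc(Ω, ℝⁿ), and suppose f satisfies the Lusin condition (N). Then lim_{k→∞} |f_k(E)| = |f(E)| for every Borel set E compactly contained in Ω, and the Jacobians Jf_k converge to Jf in L¹_loc(Ω). -/

import Mathlib

open MeasureTheory Metric Filter Topology Set
open scoped ENNReal NNReal Topology

noncomputable section

abbrev Em (n : ℕ) : Type := EuclideanSpace ℝ (Fin n)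

variable {n : ℕ}

/-- `f` is approximately differentiable at `x` with approximate derivative `L`:
there is a measurable set `S` of density `1` at `x` along which the difference
quotient tends to zero. -/
def HasApproxDerivAt (f : Em n → Em n) (L : Em n →L[ℝ] Em n) (x : Em n) : Prop :=
  ∃ S : Set (Em n), MeasurableSet S ∧
    Tendsto (fun r : ℝ => volume (S ∩ Metric.ball x r) / volume (Metric.ball x r))
      (𝓝[>] (0 : ℝ)) (𝓝 1) ∧
    Tendsto (fun y => ‖f y - f x - L (y - x)‖ / ‖y - x‖) (𝓝[S \ {x}] x) (𝓝 0)

/-- Regular approximate differentiability. -/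
def HasRegularApproxDerivAt (f : Em n → Em n) (L : Em n →L[ℝ] Em n) (x : Em n) : Prop :=
  HasApproxDerivAt f L x ∧
  ∃ r : ℕ → ℝ, (∀ j, 0 < r j) ∧ Tendsto r atTop (𝓝 (0 : ℝ)) ∧
    Tendsto (fun j => ⨆ h : {h : Em n // ‖h‖ = 1},
        ‖f (x + r j • (h : Em n)) - f x - r j • L (h : Em n)‖ / r j)
      atTop (𝓝 (0 : ℝ))

/-- Lusin condition (N) on a set `A`: images of null subsets of `A` are null. -/
def LusinN (f : Em n → Em n) (A : Set (Em n)) : Prop :=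
  ∀ E ⊆ A, volume E = 0 → volume (f '' E) = 0

/-- `f` is injective a.e. on `Ω`: injective off a null set. -/
def InjectiveAE (f : Em n → Em n) (Ω : Set (Em n)) : Prop :=
  ∃ N ⊆ Ω, volume N = 0 ∧ Set.InjOn f (Ω \ N)

/-- `f` is a homeomorphism of `Ω` onto its image. -/
def IsHomeoOnto (f : Em n → Em n) (Ω : Set (Em n)) : Prop :=
  Topology.IsEmbedding (fun x : Ω => f x)

/-- `Df` is the weak (distributional) derivative of `f` on the open set `Ω`. -/
def HasWeakDerivOn (f : Em n → Em n) (Df : Em n → Em n →L[ℝ] Em n) (Ω : Set (Em n)) : Prop :=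
  LocallyIntegrableOn f Ω volume ∧ LocallyIntegrableOn Df Ω volume ∧
  ∀ φ : Em n → ℝ, ContDiff ℝ (⊤ : ℕ∞) φ → HasCompactSupport φ → tsupport φ ⊆ Ω →
    ∀ v : Em n, ∫ x in Ω, fderiv ℝ φ x v • f x = - ∫ x in Ω, φ x • Df x v

/-- Convergence `f k → g` in `W^{1,p}_loc(Ω)`. -/
def TendstoW1pLocOn (p : ℝ) (f : ℕ → Em n → Em n) (Df : ℕ → Em n → Em n →L[ℝ] Em n)
    (g : Em n → Em n) (Dg : Em n → Em n →L[ℝ] Em n) (Ω : Set (Em n)) : Prop :=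
  ∀ K ⊆ Ω, IsCompact K →
    Tendsto (fun k => ∫⁻ x in K,
        (‖f k x - g x‖₊ : ℝ≥0∞) ^ p + (‖Df k x - Dg x‖₊ : ℝ≥0∞) ^ p) atTop (𝓝 0)

/-- Sign of a real number, as an integer. -/
def rsgn (t : ℝ) : ℤ := if 0 < t then 1 else if t < 0 then -1 else 0

section Brouwer

/-- Polynomials of bounded degree are determined at `1` by their values near `0`, linearly. -/
theorem exists_interpolation_weights (d : ℕ) {t₀ : ℝ} (ht₀ : 0 < t₀) :
    ∃ (s : Finset ℝ) (c : ℝ → ℝ), (∀ t ∈ s, 0 < t ∧ t < t₀) ∧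
      ∀ q : Polynomial ℝ, q.natDegree ≤ d → q.eval 1 = ∑ t ∈ s, c t * q.eval t := by
  obtain ⟨s, hs, hcard⟩ := (Set.Ioo_infinite ht₀).exists_subset_card_eq (d + 1)
  refine ⟨s, fun t => (Lagrange.basis s id t).eval 1, fun t ht => hs ht, fun q hq => ?_⟩
  have hdeg : q.degree < s.card := by
    rw [hcard]
    exact lt_of_le_of_lt (Polynomial.degree_le_of_natDegree_le hq)
      (by exact_mod_cast Nat.lt_succ_self d)
  have h := Lagrange.eq_interpolate (s := s) (v := id) (f := q) Function.injective_id.injOn hdeg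
  conv_lhs => rw [h, Lagrange.interpolate_apply, Polynomial.eval_finsetSum]
  refine Finset.sum_congr rfl fun t _ => ?_
  simp [mul_comm]

theorem exists_polynomial_det_one_add_smul {E : Type*} [NormedAddCommGroup E] [NormedSpace ℝ E]
    [FiniteDimensional ℝ E] (A : E →L[ℝ] E) :
    ∃ q : Polynomial ℝ, q.natDegree ≤ Module.finrank ℝ E ∧
      ∀ t : ℝ, q.eval t = (ContinuousLinearMap.id ℝ E + t • A).det := by
  classical
  let b := Module.finBasis ℝ E
  let M := LinearMap.toMatrix b b (A : E →ₗ[ℝ] E)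
  refine ⟨Matrix.det ((Polynomial.X : Polynomial ℝ) • M.map Polynomial.C
    + (1 : Matrix _ _ ℝ).map Polynomial.C), ?_, fun t => ?_⟩
  · simpa using Polynomial.natDegree_det_X_add_C_le M 1
  · rw [← Polynomial.coe_evalRingHom, RingHom.map_det]
    have hM : (Polynomial.evalRingHom t).mapMatrix
        ((Polynomial.X : Polynomial ℝ) • M.map Polynomial.C
          + (1 : Matrix _ _ ℝ).map Polynomial.C)
        = LinearMap.toMatrix b b
          ((ContinuousLinearMap.id ℝ E + t • A : E →L[ℝ] E) : E →ₗ[ℝ] E) := by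
      have h1 : LinearMap.toMatrix b b
          ((ContinuousLinearMap.id ℝ E + t • A : E →L[ℝ] E) : E →ₗ[ℝ] E) = 1 + t • M := by
        simp [M]
      rw [h1]
      ext i j
      simp [Matrix.one_apply, add_comm, apply_ite]
      ring
    rw [hM, LinearMap.det_toMatrix]

/-- A perturbation of the identity by a strict contraction is bijective. -/
theorem bijective_add_of_lipschitzWith {F : Type*} [NormedAddCommGroup F] [CompleteSpace F]
    {w : F → F} {K : ℝ≥0} (hK : K < 1) (hw : LipschitzWith K w) :
    Function.Bijective fun x => x + w x := by
  constructor
  · intro x y hxy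
    by_contra hne
    have h1 : x - y = w y - w x := by
      have : x + w x = y + w y := hxy
      rw [sub_eq_sub_iff_add_eq_add, this, add_comm]
    have h2 := hw.dist_le_mul x y
    rw [dist_eq_norm, dist_eq_norm, norm_sub_rev, ← h1] at h2
    have h3 : 0 < ‖x - y‖ := norm_pos_iff.2 (sub_ne_zero.2 hne)
    have h4 : (K : ℝ) < 1 := by exact_mod_cast hK
    nlinarith
  · intro y
    have hc : ContractingWith K fun x => y - w x := by
      refine ⟨hK, LipschitzWith.of_dist_le_mul fun a b => ?_⟩
      rw [dist_sub_left]
      exact hw.dist_le_mul a b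
    refine ⟨hc.fixedPoint, ?_⟩
    have := hc.fixedPoint_isFixedPt
    simp only [Function.IsFixedPt] at this
    exact (sub_eq_iff_eq_add.1 this).symm

/-- Extending by zero a Lipschitz map on a ball that vanishes on the sphere. -/
theorem lipschitzWith_indicator_ball {E F : Type*} [NormedAddCommGroup E] [NormedSpace ℝ E]
    [NormedAddCommGroup F]
    {w : E → F} {R : ℝ} {K : ℝ≥0}
    (hw : LipschitzOnWith K w (closedBall 0 R)) (h0 : ∀ x, ‖x‖ = R → w x = 0) :
    LipschitzWith K ((ball (0 : E) R).indicator w) := by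
  have key : ∀ x y : E, x ∈ ball (0 : E) R → y ∉ ball (0 : E) R → ‖w x‖ ≤ K * dist x y := by
    intro x y hx hy
    rw [mem_ball_zero_iff] at hx hy
    have hc : ContinuousOn (fun s : ℝ => ‖AffineMap.lineMap x y s‖) (Icc 0 1) := by
      fun_prop
    obtain ⟨s, hs, hsR⟩ := intermediate_value_Icc zero_le_one hc
      (show R ∈ Icc _ _ by simpa using ⟨hx.le, not_lt.1 hy⟩)
    set z : E := AffineMap.lineMap x y s
    have hz : w z = 0 := h0 z hsR
    have h1 := hw.dist_le_mul x (by simpa using hx.le) z (by simpa using hsR.le)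
    rw [hz, dist_zero_right] at h1
    refine h1.trans (mul_le_mul_of_nonneg_left ?_ K.2)
    rw [dist_comm, dist_lineMap_left, Real.norm_of_nonneg hs.1]
    exact mul_le_of_le_one_left dist_nonneg hs.2
  refine LipschitzWith.of_dist_le_mul fun x y => ?_
  by_cases hx : x ∈ ball (0 : E) R <;> by_cases hy : y ∈ ball (0 : E) R
  · rw [indicator_of_mem hx, indicator_of_mem hy]
    exact hw.dist_le_mul x (ball_subset_closedBall hx) y (ball_subset_closedBall hy)
  · rw [indicator_of_mem hx, indicator_of_notMem hy, dist_zero_right]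
    exact key x y hx hy
  · rw [indicator_of_notMem hx, indicator_of_mem hy, dist_zero_left, dist_comm]
    exact key y x hy hx
  · rw [indicator_of_notMem hx, indicator_of_notMem hy, dist_self]
    positivity

/-- There is no `C¹` retraction of a ball onto its boundary sphere. -/
theorem no_contDiff_retraction {E : Type*} [NormedAddCommGroup E] [InnerProductSpace ℝ E]
    [FiniteDimensional ℝ E] {r : E → E} {R : ℝ} (hR : 0 < R) (hr : ContDiff ℝ 1 r)
    (hnorm : ∀ x, ‖r x‖ = R) (hid : ∀ x, ‖x‖ = R → r x = x) : False := by
  let _ : MeasurableSpace E := borel E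
  have _ : BorelSpace E := ⟨rfl⟩
  set w : E → E := fun x => r x - x with hwdef
  have hw : ContDiff ℝ 1 w := hr.sub contDiff_id
  obtain ⟨K, hK⟩ := hw.contDiffOn.exists_lipschitzOnWith one_ne_zero (convex_closedBall (0 : E) R)
    (isCompact_closedBall 0 R)
  have hW := lipschitzWith_indicator_ball hK fun x hx => by simp [hwdef, hid x hx]
  set W := (ball (0 : E) R).indicator w
  have hDw : Continuous (fderiv ℝ w) := hw.continuous_fderiv one_ne_zero
  obtain ⟨C, hC⟩ := (isCompact_closedBall (0 : E) R).exists_bound_of_continuousOn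
    hDw.continuousOn
  have hdetc : ∀ {X : Type _} [TopologicalSpace X] {B : X → E →L[ℝ] E}, Continuous B →
      Continuous fun x => (B x).det := fun hB => ContinuousLinearMap.continuous_det.comp hB
  obtain ⟨δ, hδ, hdet⟩ : ∃ δ > 0, ∀ B : E →L[ℝ] E, ‖B‖ < δ →
      0 < (ContinuousLinearMap.id ℝ E + B).det := by
    have hcont : Continuous fun B : E →L[ℝ] E => (ContinuousLinearMap.id ℝ E + B).det :=
      hdetc (by fun_prop)
    have : ∀ᶠ B in 𝓝 (0 : E →L[ℝ] E), 0 < (ContinuousLinearMap.id ℝ E + B).det :=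
      hcont.continuousAt.eventually_const_lt (by simp [ContinuousLinearMap.det])
    obtain ⟨δ, hδ, h⟩ := Metric.eventually_nhds_iff.1 this
    exact ⟨δ, hδ, fun B hB => h (by simpa using hB)⟩
  obtain ⟨t₀, ht₀, ht₀K, ht₀C⟩ : ∃ t₀ : ℝ, 0 < t₀ ∧ t₀ * K < 1 ∧ t₀ * C < δ := by
    have hCC : C ≤ |C| := le_abs_self C
    have hKK := K.2
    refine ⟨min (1 / (2 * (K + 1))) (δ / (2 * (|C| + 1))), by positivity, ?_, ?_⟩
    · calc _ ≤ (1 / (2 * ((K : ℝ) + 1))) * K := by gcongr; exact min_le_left _ _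
        _ < 1 := by rw [div_mul_eq_mul_div, div_lt_one (by positivity)]; linarith
    · calc _ ≤ min (1 / (2 * ((K : ℝ) + 1))) (δ / (2 * (|C| + 1))) * |C| := by gcongr
        _ ≤ (δ / (2 * (|C| + 1))) * |C| := by gcongr; exact min_le_right _ _
        _ < δ := by
          rw [div_mul_eq_mul_div, div_lt_iff₀ (by positivity)]; nlinarith [abs_nonneg C]
  have hvol : ∀ t : ℝ, 0 < t → t < t₀ →
      ∫ x in ball (0 : E) R, (ContinuousLinearMap.id ℝ E + t • fderiv ℝ w x).det
        = volume.real (ball (0 : E) R) := by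
    intro t ht htt
    have hCn : 0 ≤ C := (norm_nonneg _).trans (hC 0 (by simp [hR.le]))
    have hpos : ∀ x ∈ ball (0 : E) R,
        0 < (ContinuousLinearMap.id ℝ E + t • fderiv ℝ w x).det := fun x hx => by
      refine hdet _ ?_
      rw [norm_smul, Real.norm_of_nonneg ht.le]
      calc t * ‖fderiv ℝ w x‖ ≤ t₀ * C :=
            mul_le_mul htt.le (hC x (ball_subset_closedBall hx)) (norm_nonneg _) ht₀.le
        _ < δ := ht₀C
    have hbij : Function.Bijective fun x => x + t • W x := by
      refine bijective_add_of_lipschitzWith (K := ‖t‖₊ * K) ?_ ((lipschitzWith_smul t).comp hW)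
      rw [← NNReal.coe_lt_coe]
      simp only [NNReal.coe_mul, coe_nnnorm, NNReal.coe_one, Real.norm_of_nonneg ht.le]
      exact lt_of_le_of_lt (mul_le_mul_of_nonneg_right htt.le K.2) ht₀K
    have hout : ∀ x ∉ ball (0 : E) R, x + t • W x = x := fun x hx => by
      simp [W, indicator_of_notMem hx]
    have himg : (fun x => x + t • W x) '' ball 0 R = ball 0 R := by
      have h1 : (fun x => x + t • W x) '' (ball 0 R)ᶜ = (ball 0 R)ᶜ := by
        conv_rhs => rw [← image_id (ball (0 : E) R)ᶜ]
        exact image_congr hout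
      have h2 := image_compl_eq (s := ball (0 : E) R) hbij
      rw [h1] at h2
      exact (compl_injective h2).symm
    have harea := lintegral_abs_det_fderiv_eq_addHaar_image (volume : Measure E)
      (s := ball 0 R) measurableSet_ball (f := fun x => x + t • W x)
      (f' := fun x => ContinuousLinearMap.id ℝ E + t • fderiv ℝ w x) (fun x hx => by
        have h : HasFDerivAt (fun x => x + t • w x)
            (ContinuousLinearMap.id ℝ E + t • fderiv ℝ w x) x :=
          (hasFDerivAt_id x).add
            ((hw.differentiable one_ne_zero x).hasFDerivAt.const_smul t)
        refine h.hasFDerivWithinAt.congr (fun y hy => ?_) ?_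
        · simp [W, indicator_of_mem hy]
        · simp [W, indicator_of_mem hx]) hbij.1.injOn
    rw [himg] at harea
    rw [integral_eq_lintegral_of_nonneg_ae]
    · rw [Measure.real, ← harea]
      congr 1
      refine setLIntegral_congr_fun measurableSet_ball fun x hx => ?_
      simp only [abs_of_pos (hpos x hx)]
    · exact (ae_restrict_mem measurableSet_ball).mono fun x hx => (hpos x hx).le
    · exact (Continuous.aestronglyMeasurable (hdetc (by fun_prop)))
  obtain ⟨s, c, hs, hc⟩ := exists_interpolation_weights (Module.finrank ℝ E) ht₀
  have hintegrable : ∀ t : ℝ, IntegrableOn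
      (fun x => (ContinuousLinearMap.id ℝ E + t • fderiv ℝ w x).det) (ball (0 : E) R) := by
    intro t
    refine IntegrableOn.mono_set ?_ ball_subset_closedBall
    exact (hdetc (by fun_prop)).continuousOn.integrableOn_compact (isCompact_closedBall 0 R)
  have hone : volume.real (ball (0 : E) R)
      = ∫ x in ball (0 : E) R, (ContinuousLinearMap.id ℝ E + (1 : ℝ) • fderiv ℝ w x).det := by
    have h1 : ∀ x, (ContinuousLinearMap.id ℝ E + (1 : ℝ) • fderiv ℝ w x).det
        = ∑ t ∈ s, c t * (ContinuousLinearMap.id ℝ E + t • fderiv ℝ w x).det := by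
      intro x
      obtain ⟨q, hq, hqe⟩ := exists_polynomial_det_one_add_smul (fderiv ℝ w x)
      simp_rw [← hqe]
      exact hc q hq
    simp_rw [h1]
    rw [integral_finsetSum _ fun t _ => (hintegrable t).const_mul _]
    simp_rw [integral_const_mul]
    rw [Finset.sum_congr rfl fun t ht => by rw [hvol t (hs t ht).1 (hs t ht).2], ← Finset.sum_mul]
    have := hc 1 (by simp)
    simp only [Polynomial.eval_one, mul_one] at this
    rw [← this, one_mul]
  have hzero : ∀ x, (ContinuousLinearMap.id ℝ E + (1 : ℝ) • fderiv ℝ w x).det = 0 := by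
    intro x
    have hd : HasFDerivAt r (fderiv ℝ r x) x := (hr.differentiable one_ne_zero x).hasFDerivAt
    have hfw : fderiv ℝ w x = fderiv ℝ r x - ContinuousLinearMap.id ℝ E :=
      (hd.sub (hasFDerivAt_id x)).fderiv
    rw [hfw, one_smul, add_sub_cancel]
    have horth : ∀ v, inner ℝ (r x) (fderiv ℝ r x v) = 0 := by
      intro v
      have h1 := hd.norm_sq
      have h2 : (fun x => ‖r x‖ ^ 2) = fun _ => R ^ 2 := by
        funext y; rw [hnorm]
      rw [h2] at h1
      have h3 := h1.unique (hasFDerivAt_const _ _)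
      have h4 := congrArg (fun L : E →L[ℝ] ℝ => L v) h3
      simpa using h4
    by_contra hne
    have hsurj : Function.Surjective (fderiv ℝ r x) := by
      have hu : IsUnit (LinearMap.det (fderiv ℝ r x : E →ₗ[ℝ] E)) := isUnit_iff_ne_zero.2 hne
      intro y
      obtain ⟨v, hv⟩ := (LinearMap.equivOfIsUnitDet hu).surjective y
      exact ⟨v, by simpa using hv⟩
    obtain ⟨v, hv⟩ := hsurj (r x)
    have h5 := horth v
    rw [hv, real_inner_self_eq_norm_sq, hnorm] at h5
    exact hR.ne' (pow_eq_zero_iff two_ne_zero |>.1 h5)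
  simp_rw [hzero] at hone
  rw [integral_zero] at hone
  have : 0 < volume.real (ball (0 : E) R) :=
    ENNReal.toReal_pos (measure_ball_pos _ _ hR).ne' measure_ball_lt_top.ne
  exact this.ne' hone

/-- A compactly supported continuous perturbation of the identity has a zero. -/
theorem exists_add_eq_zero_of_hasCompactSupport {E : Type*} [NormedAddCommGroup E]
    [InnerProductSpace ℝ E] [FiniteDimensional ℝ E] {ψ : E → E} (hψ : Continuous ψ)
    (hsupp : HasCompactSupport ψ) : ∃ x, x + ψ x = 0 := by
  by_contra! hne
  obtain ⟨φ, hφ, hφd, hφs⟩ := hψ.exists_contDiff_approx 1 (ε := fun x => ‖x + ψ x‖)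
    (by fun_prop) fun x => norm_pos_iff.2 (hne x)
  obtain ⟨R, hR, hφR⟩ : ∃ R : ℝ, 0 < R ∧ ∀ x, R ≤ ‖x‖ → φ x = 0 := by
    obtain ⟨R, hR⟩ := hsupp.isCompact.isBounded.subset_ball (0 : E)
    refine ⟨max R 1, by positivity, fun x hx => ?_⟩
    by_contra h
    have h1 : x ∈ ball (0 : E) R := hR (subset_tsupport _ (hφs h))
    rw [mem_ball_zero_iff] at h1
    exact absurd h1 (not_lt.2 ((le_max_left _ _).trans hx))
  have hF : ∀ x, x + φ x ≠ 0 := by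
    intro x hx
    have h1 := hφd x
    rw [dist_eq_norm, norm_sub_rev] at h1
    have h2 : ψ x - φ x = x + ψ x - (x + φ x) := by abel
    rw [h2, hx, sub_zero] at h1
    exact lt_irrefl _ h1
  have hFc : ContDiff ℝ 1 fun x => x + φ x := contDiff_id.add hφ
  refine no_contDiff_retraction (r := fun x => (R * ‖x + φ x‖⁻¹) • (x + φ x)) hR ?_ ?_ ?_
  · exact (contDiff_const.mul ((hFc.norm ℝ hF).inv fun x => norm_ne_zero_iff.2 (hF x))).smul hFc
  · intro x
    rw [norm_smul, norm_mul, norm_inv, norm_norm, Real.norm_of_nonneg hR.le, mul_assoc,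
      inv_mul_cancel₀ (norm_ne_zero_iff.2 (hF x)), mul_one]
  · intro x hx
    simp only [hφR x hx.ge, add_zero, hx, mul_inv_cancel₀ hR.ne', one_smul]

/-- A continuous map of the unit ball that is uniformly close to the identity has a zero. -/
theorem exists_eq_zero_of_norm_sub_le {E : Type*} [NormedAddCommGroup E]
    [InnerProductSpace ℝ E] [FiniteDimensional ℝ E] {F : E → E}
    (hF : ContinuousOn F (closedBall 0 1)) (hFd : ∀ x ∈ closedBall (0 : E) 1, ‖F x - x‖ ≤ 1 / 2) :
    ∃ x ∈ closedBall (0 : E) 1, F x = 0 := by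
  let pr : E → E := fun x => (max 1 ‖x‖)⁻¹ • x
  have hprc : Continuous pr :=
    (Continuous.inv₀ (by fun_prop) fun x => (by positivity)).smul continuous_id
  have hprm : ∀ x, pr x ∈ closedBall (0 : E) 1 := fun x => by
    rw [mem_closedBall_zero_iff, norm_smul, norm_inv, Real.norm_of_nonneg (by positivity)]
    exact inv_mul_le_one_of_le₀ (le_max_right _ _) (by positivity)
  have hpr : ∀ x ∈ closedBall (0 : E) 1, pr x = x := fun x hx => by
    rw [mem_closedBall_zero_iff] at hx
    simp [pr, max_eq_left hx]
  let κ : E → ℝ := fun x => max 0 (min 1 (2 - ‖x‖))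
  have hκ1 : ∀ x, κ x ≤ 1 := fun x => max_le zero_le_one (min_le_left _ _)
  have hκ0 : ∀ x, 0 ≤ κ x := fun x => le_max_left _ _
  let ψ : E → E := fun x => κ x • (F (pr x) - pr x)
  have hψc : Continuous ψ := by
    refine Continuous.smul (by fun_prop) (Continuous.sub ?_ hprc)
    exact hF.comp_continuous hprc hprm
  have hψs : HasCompactSupport ψ := by
    refine HasCompactSupport.intro (isCompact_closedBall (0 : E) 2) fun x hx => ?_
    rw [mem_closedBall_zero_iff, not_le] at hx
    have : κ x = 0 := max_eq_left ((min_le_right _ _).trans (by linarith))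
    simp [ψ, this]
  obtain ⟨x, hx⟩ := exists_add_eq_zero_of_hasCompactSupport hψc hψs
  have hxle : x ∈ closedBall (0 : E) 1 := by
    rw [mem_closedBall_zero_iff]
    have h1 : ‖x‖ = ‖ψ x‖ := by
      rw [← norm_neg, neg_eq_of_add_eq_zero_right hx]
    have h2 : ‖ψ x‖ ≤ 1 * (1 / 2) := by
      rw [norm_smul, Real.norm_of_nonneg (hκ0 x)]
      exact mul_le_mul (hκ1 x) (hFd _ (hprm x)) (norm_nonneg _) zero_le_one
    rw [h1]; linarith
  refine ⟨x, hxle, ?_⟩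
  have hκ : κ x = 1 := by
    rw [mem_closedBall_zero_iff] at hxle
    simp only [κ]
    rw [min_eq_left (by linarith), max_eq_right zero_le_one]
  simpa [ψ, hκ, hpr x hxle] using hx

/-- Invariance of domain at the centre of the unit ball. -/
theorem image_closedBall_mem_nhds_unit {E : Type*} [NormedAddCommGroup E]
    [InnerProductSpace ℝ E] [FiniteDimensional ℝ E] {h : E → E}
    (hc : ContinuousOn h (closedBall 0 1)) (hinj : InjOn h (closedBall 0 1)) :
    h '' closedBall 0 1 ∈ 𝓝 (h 0) := by
  by_contra hnot
  let _ : MeasurableSpace E := borel E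
  have _ : BorelSpace E := ⟨rfl⟩
  set B := closedBall (0 : E) 1
  have h0B : (0 : E) ∈ B := by simp [B]
  have hBc : IsCompact B := isCompact_closedBall 0 1
  obtain ⟨G, hGc, hG⟩ : ∃ G : E → E, Continuous G ∧ ∀ x ∈ B, G (h x) = x := by
    have : CompactSpace B := isCompact_iff_compactSpace.1 hBc
    have hemb : IsClosedEmbedding (B.domRestrict h) :=
      (continuousOn_iff_continuous_domRestrict.1 hc).isClosedEmbedding (injOn_iff_injective.1 hinj)
    obtain ⟨G, hG⟩ := ContinuousMap.exists_extension hemb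
      (⟨Subtype.val, continuous_subtype_val⟩ : C(B, E))
    exact ⟨G, G.continuous, fun x hx => congrArg (fun f : C(B, E) => f ⟨x, hx⟩) hG⟩
  obtain ⟨ε, hε, hGε⟩ : ∃ ε > 0, ∀ y, dist y (h 0) < 2 * ε → ‖G y‖ < 1 / 16 := by
    have h1 : Tendsto G (𝓝 (h 0)) (𝓝 0) := by
      have := hGc.tendsto (h 0)
      rwa [hG 0 h0B] at this
    obtain ⟨ε, hε, h2⟩ := Metric.tendsto_nhds_nhds.1 h1 (1 / 16) (by norm_num)
    exact ⟨ε / 2, by positivity, fun y hy => by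
      simpa using h2 (show dist y (h 0) < ε by linarith)⟩
  obtain ⟨y₁, hy₁, hy₁K⟩ : ∃ y₁, dist y₁ (h 0) < ε ∧ y₁ ∉ h '' B := by
    by_contra! hall
    exact hnot (Filter.mem_of_superset (ball_mem_nhds _ hε) fun y hy => hall y hy)
  let Φ : E → E := fun y => y₁ + max (ε / ‖y - y₁‖) 1 • (y - y₁)
  have hsub : ∀ x ∈ B, ‖h x - y₁‖ ≠ 0 := fun x hx hx0 => by
    rw [norm_eq_zero, sub_eq_zero] at hx0
    exact hy₁K ⟨x, hx, hx0⟩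
  have hΦfar : ∀ y, ε ≤ ‖y - y₁‖ → Φ y = y := fun y hy => by
    have : ε / ‖y - y₁‖ ≤ 1 := div_le_one_of_le₀ hy (norm_nonneg _)
    simp [Φ, max_eq_right this]
  have hΦnear : ∀ y, ‖y - y₁‖ ≠ 0 → ‖y - y₁‖ < ε → ‖Φ y - y₁‖ = ε := fun y hy0 hy => by
    have h1 : 1 ≤ ε / ‖y - y₁‖ := (one_le_div (lt_of_le_of_ne (norm_nonneg _) hy0.symm)).2 hy.le
    simp only [Φ, max_eq_left h1, add_sub_cancel_left]
    rw [norm_smul, norm_div, norm_norm, Real.norm_of_nonneg hε.le, div_mul_cancel₀ _ hy0]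
  obtain ⟨δ, hδ, hδ1, hGδ⟩ : ∃ δ : ℝ, 0 < δ ∧ δ ≤ 1 / 16 ∧
      ∀ x ∈ B, ε ≤ ‖h x - y₁‖ → δ ≤ ‖x‖ := by
    have hev : ∀ᶠ x in 𝓝[B] (0 : E), ‖h x - y₁‖ < ε := by
      have h1 : ContinuousWithinAt (fun x => ‖h x - y₁‖) B 0 := ((hc 0 h0B).sub_const y₁).norm
      refine h1.eventually_lt_const ?_
      change ‖h 0 - y₁‖ < ε
      rwa [← dist_eq_norm, dist_comm]
    obtain ⟨δ, hδ, h2⟩ := Metric.eventually_nhds_iff.1 (eventually_nhdsWithin_iff.1 hev)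
    refine ⟨min δ (1 / 16), by positivity, min_le_right _ _, fun x hx hxε => ?_⟩
    by_contra! hlt
    exact absurd (h2 (by simpa using hlt.trans_le (min_le_left _ _)) hx) (not_lt.2 hxε)
  obtain ⟨P, hP, hPG, -⟩ := hGc.exists_contDiff_approx 1 (ε := fun _ => δ / 4) continuous_const
    fun _ => by positivity
  obtain ⟨v, hv, hvP⟩ : ∃ v : E, ‖v‖ < δ / 4 ∧ v ∉ P '' sphere y₁ ε := by
    have hnull : volume (P '' sphere y₁ ε) = 0 :=
      addHaar_image_eq_zero_of_differentiableOn_of_addHaar_eq_zero volume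
        (hP.differentiable one_ne_zero).differentiableOn
        (Measure.addHaar_sphere_of_ne_zero volume y₁ hε.ne')
    by_contra! hall
    have h1 : ball (0 : E) (δ / 4) ⊆ P '' sphere y₁ ε := fun v hv => hall v (by simpa using hv)
    exact (measure_ball_pos volume (0 : E) (by positivity : 0 < δ / 4)).ne'
      (measure_mono_null h1 hnull)
  have hPvG : ∀ y, ‖P y - v - G y‖ < δ / 2 := fun y => by
    have h1 := hPG y
    rw [dist_eq_norm] at h1
    calc ‖P y - v - G y‖ = ‖(P y - G y) - v‖ := by congr 1; abel
      _ ≤ ‖P y - G y‖ + ‖v‖ := norm_sub_le _ _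
      _ < δ / 2 := by linarith
  obtain ⟨x, hxB, hx⟩ := exists_eq_zero_of_norm_sub_le (F := fun x => P (Φ (h x)) - v) (by
      refine ContinuousOn.sub ?_ continuousOn_const
      refine hP.continuous.comp_continuousOn (continuousOn_const.add (ContinuousOn.smul ?_ ?_))
      · refine ContinuousOn.sup ?_ continuousOn_const
        exact continuousOn_const.div (hc.sub continuousOn_const).norm hsub
      · exact hc.sub continuousOn_const) (fun x hx => by
    rcases le_or_gt ε ‖h x - y₁‖ with hfar | hnear
    · have h1 := hPvG (h x)
      rw [hG x hx] at h1
      simp only [hΦfar _ hfar]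
      linarith
    · have h1 := hPvG (Φ (h x))
      have h2 : ‖G (Φ (h x))‖ < 1 / 16 := hGε _ (by
        have := hΦnear _ (hsub x hx) hnear
        calc dist (Φ (h x)) (h 0) ≤ dist (Φ (h x)) y₁ + dist y₁ (h 0) := dist_triangle _ _ _
          _ < 2 * ε := by rw [dist_eq_norm (Φ (h x)), this]; linarith)
      have h3 : ‖G (h x)‖ < 1 / 16 := hGε _ (by
        calc dist (h x) (h 0) ≤ dist (h x) y₁ + dist y₁ (h 0) := dist_triangle _ _ _
          _ < 2 * ε := by rw [dist_eq_norm (h x)]; linarith)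
      rw [hG x hx] at h3
      calc ‖P (Φ (h x)) - v - x‖ = ‖(P (Φ (h x)) - v - G (Φ (h x))) + G (Φ (h x)) - x‖ := by
            congr 1; abel
        _ ≤ ‖P (Φ (h x)) - v - G (Φ (h x))‖ + ‖G (Φ (h x))‖ + ‖x‖ :=
            (norm_sub_le _ _).trans (by gcongr; exact norm_add_le _ _)
        _ ≤ 1 / 2 := by linarith)
  rcases le_or_gt ε ‖h x - y₁‖ with hfar | hnear
  · have h1 := hPvG (h x)
    simp only [hΦfar _ hfar] at hx
    rw [hx, hG x hxB, zero_sub, norm_neg] at h1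
    linarith [hGδ x hxB hfar]
  · refine hvP ⟨Φ (h x), ?_, sub_eq_zero.1 hx⟩
    rw [mem_sphere, dist_eq_norm]
    exact hΦnear _ (hsub x hxB) hnear

/-- Invariance of domain. -/
theorem image_mem_nhds_of_injOn {E : Type*} [NormedAddCommGroup E]
    [InnerProductSpace ℝ E] [FiniteDimensional ℝ E] {h : E → E} {s : Set E} {x₀ : E}
    (hs : s ∈ 𝓝 x₀) (hc : ContinuousOn h s) (hinj : InjOn h s) : h '' s ∈ 𝓝 (h x₀) := by
  obtain ⟨ρ, hρ, hsub⟩ := Metric.nhds_basis_closedBall.mem_iff.1 hs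
  let a : E → E := fun x => x₀ + ρ • x
  have ha : MapsTo a (closedBall 0 1) s := fun x hx => hsub (by
    rw [mem_closedBall_zero_iff] at hx
    simp only [a, mem_closedBall, dist_self_add_left, norm_smul, Real.norm_of_nonneg hρ.le]
    exact mul_le_of_le_one_right hρ.le hx)
  have hainj : Function.Injective a := fun x y hxy =>
    smul_right_injective E hρ.ne' (add_left_cancel hxy)
  have h1 := image_closedBall_mem_nhds_unit (h := h ∘ a)
    (hc.comp (by fun_prop) ha) (hinj.comp hainj.injOn ha)
  simp only [Function.comp_apply, a, smul_zero, add_zero] at h1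
  refine mem_of_superset h1 ?_
  rw [image_subset_iff]
  exact fun x hx => ⟨a x, ha hx, rfl⟩

/-- An injective continuous map on a compact set attains its largest distance from a given point
on the frontier. -/
theorem image_subset_closedBall_of_frontier {E : Type*} [NormedAddCommGroup E]
    [InnerProductSpace ℝ E] [FiniteDimensional ℝ E] [Nontrivial E] {h : E → E} {s : Set E}
    (hs : IsCompact s) (hc : ContinuousOn h s) (hinj : InjOn h s) {c : E} {ρ : ℝ}
    (hfr : ∀ x ∈ s, x ∉ interior s → h x ∈ closedBall c ρ) : ∀ x ∈ s, h x ∈ closedBall c ρ := by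
  intro x hx
  obtain ⟨m, hms, hm⟩ := hs.exists_isMaxOn ⟨x, hx⟩ 
    (f := fun x => dist (h x) c) (by fun_prop)
  have hmax : ∀ y ∈ s, dist (h y) c ≤ dist (h m) c := fun y hy => hm hy
  by_cases hmi : m ∈ interior s
  · exfalso
    have hnhds := image_mem_nhds_of_injOn (mem_interior_iff_mem_nhds.1 hmi) hc hinj
    obtain ⟨δ, hδ, hsub⟩ := Metric.nhds_basis_closedBall.mem_iff.1 hnhds
    obtain ⟨v, hv1, hv2⟩ : ∃ v : E, ‖v‖ = δ ∧ ‖h m - c + v‖ = ‖h m - c‖ + δ := by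
      by_cases h0 : h m - c = 0
      · obtain ⟨v, hv⟩ := exists_norm_eq E hδ.le
        exact ⟨v, hv, by simp [h0, hv]⟩
      · have h1 : 0 < ‖h m - c‖ := norm_pos_iff.2 h0
        refine ⟨(δ / ‖h m - c‖) • (h m - c), ?_, ?_⟩
        · rw [norm_smul, Real.norm_of_nonneg (by positivity), div_mul_cancel₀ _ h1.ne']
        · have h2 : h m - c + (δ / ‖h m - c‖) • (h m - c) = (1 + δ / ‖h m - c‖) • (h m - c) := by
            rw [add_smul, one_smul]
          rw [h2, norm_smul, Real.norm_of_nonneg (by positivity), add_mul, one_mul,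
            div_mul_cancel₀ _ h1.ne']
    obtain ⟨y, hy, hyv⟩ := hsub (show h m + v ∈ closedBall (h m) δ by simp [hv1])
    have h3 := hmax y hy
    rw [hyv, dist_eq_norm, dist_eq_norm, add_sub_right_comm, hv2] at h3
    linarith
  · exact (hmax x hx).trans (hfr m hms hmi)

end Brouwer

section Estimates

variable {F V : Type*} [NormedAddCommGroup F] [NormedSpace ℝ F] [FiniteDimensional ℝ F]
  [MeasurableSpace F] [BorelSpace F] [NormedAddCommGroup V] [NormedSpace ℝ V] [CompleteSpace V]

theorem enorm_sub_le_lintegral_fderiv {G W : Type*} [NormedAddCommGroup G] [NormedSpace ℝ G]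
    [NormedAddCommGroup W] [NormedSpace ℝ W] [CompleteSpace W] {v : G → W} (hv : ContDiff ℝ 1 v)
    (x z : G) :
    ‖v z - v x‖ₑ ≤ ‖z - x‖ₑ * ∫⁻ s in Ioc (0 : ℝ) 1, ‖fderiv ℝ v (x + s • (z - x))‖ₑ := by
  have hD : Continuous (fderiv ℝ v) := hv.continuous_fderiv one_ne_zero
  have h1 : ∀ s : ℝ, HasDerivAt (fun s : ℝ => v (x + s • (z - x)))
      (fderiv ℝ v (x + s • (z - x)) (z - x)) s := fun s => by
    have h2 : HasDerivAt (fun s : ℝ => x + s • (z - x)) (z - x) s := by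
      simpa using ((hasDerivAt_id s).smul_const (z - x)).const_add x
    exact ((hv.differentiable one_ne_zero _).hasFDerivAt).comp_hasDerivAt s h2
  have hcont : Continuous fun s : ℝ => fderiv ℝ v (x + s • (z - x)) (z - x) := by fun_prop
  have h3 := intervalIntegral.integral_eq_sub_of_hasDerivAt (a := 0) (b := 1)
    (fun s _ => h1 s) (hcont.intervalIntegrable 0 1)
  simp only [one_smul, zero_smul, add_zero, add_sub_cancel] at h3
  rw [← h3, intervalIntegral.integral_of_le zero_le_one]
  refine (enorm_integral_le_lintegral_enorm _).trans ?_
  rw [← lintegral_const_mul' _ _ enorm_ne_top]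
  refine lintegral_mono fun s => ?_
  rw [mul_comm]
  exact ContinuousLinearMap.le_opENorm _ _

/-- The mean oscillation of a `C¹` function around a point is controlled by integrals of its
derivative over rescaled copies of the domain. -/
theorem lintegral_enorm_sub_le (μ : Measure F) [μ.IsAddHaarMeasure] {v : F → V}
    (hv : ContDiff ℝ 1 v) (x : F) {S : Set F} (hS : MeasurableSet S) {D : ℝ≥0∞}
    (hD : ∀ z ∈ S, ‖z - x‖ₑ ≤ D) :
    ∫⁻ z in S, ‖v z - v x‖ₑ ∂μ ≤ D * ∫⁻ s in Ioc (0 : ℝ) 1,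
      (ENNReal.ofReal (s ^ Module.finrank ℝ F))⁻¹ *
        ∫⁻ y in (fun z => x + s • (z - x)) '' S, ‖fderiv ℝ v y‖ₑ ∂μ := by
  have hDv : Continuous (fderiv ℝ v) := hv.continuous_fderiv one_ne_zero
  have hmeas : Measurable fun q : F × ℝ => ‖fderiv ℝ v (x + q.2 • (q.1 - x))‖ₑ := by
    have hcont : Continuous fun q : F × ℝ => ‖fderiv ℝ v (x + q.2 • (q.1 - x))‖ₑ := by fun_prop
    exact hcont.measurable
  calc ∫⁻ z in S, ‖v z - v x‖ₑ ∂μ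
      ≤ ∫⁻ z in S, D * (∫⁻ s in Ioc (0 : ℝ) 1, ‖fderiv ℝ v (x + s • (z - x))‖ₑ) ∂μ :=
        setLIntegral_mono' hS fun z hz =>
          (enorm_sub_le_lintegral_fderiv hv x z).trans (by gcongr; exact hD z hz)
    _ = D * ∫⁻ z in S, (∫⁻ s in Ioc (0 : ℝ) 1, ‖fderiv ℝ v (x + s • (z - x))‖ₑ) ∂μ :=
        lintegral_const_mul _ hmeas.lintegral_prod_right'
    _ = D * ∫⁻ s in Ioc (0 : ℝ) 1, ∫⁻ z in S, ‖fderiv ℝ v (x + s • (z - x))‖ₑ ∂μ := by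
        rw [lintegral_lintegral_swap hmeas.aemeasurable]
    _ = _ := by
        congr 1
        refine setLIntegral_congr_fun measurableSet_Ioc fun s hs => ?_
        have hs0 : 0 < s ^ Module.finrank ℝ F := pow_pos hs.1 _
        have hchange := lintegral_image_eq_lintegral_abs_det_fderiv_mul μ hS
          (f := fun z => x + s • (z - x)) (f' := fun _ => s • ContinuousLinearMap.id ℝ F)
          (fun z _ => by
            have : HasFDerivAt (fun z => x + s • (z - x)) (s • ContinuousLinearMap.id ℝ F) z :=
              (((hasFDerivAt_id z).sub_const x).const_smul s).const_add x
            exact this.hasFDerivWithinAt)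
          (fun a _ b _ hab => by
            have := smul_right_injective F hs.1.ne' (add_left_cancel hab)
            exact sub_left_injective this)
          (fun y => ‖fderiv ℝ v y‖ₑ)
        have hdet : (s • ContinuousLinearMap.id ℝ F).det = s ^ Module.finrank ℝ F := by
          simp [ContinuousLinearMap.det]
        simp only [hchange, hdet, abs_of_pos hs0]
        rw [lintegral_const_mul' _ _ ENNReal.ofReal_ne_top, ← mul_assoc,
          ENNReal.inv_mul_cancel (ENNReal.ofReal_pos.2 hs0).ne' ENNReal.ofReal_ne_top, one_mul]

theorem image_homothety_closedBall_subset {G : Type*} [NormedAddCommGroup G] [NormedSpace ℝ G]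
    (x : G) {s r : ℝ} (hs : 0 ≤ s) :
    (fun z => x + s • (z - x)) '' closedBall x r ⊆ closedBall x (s * r) := by
  rintro _ ⟨z, hz, rfl⟩
  rw [mem_closedBall, dist_eq_norm] at hz ⊢
  rw [add_sub_cancel_left, norm_smul, Real.norm_of_nonneg hs]
  exact mul_le_mul_of_nonneg_left hz hs

theorem lintegral_closedBall_enorm_sub_le (μ : Measure F) [μ.IsAddHaarMeasure] {v : F → V}
    (hv : ContDiff ℝ 1 v) (x : F) {r : ℝ} (hr : 0 < r) {lam : ℝ≥0∞}
    (hM : ∀ ρ, 0 < ρ → ρ ≤ r →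
      ∫⁻ y in closedBall x ρ, ‖fderiv ℝ v y‖ₑ ∂μ ≤ lam * μ (closedBall x ρ)) :
    ∫⁻ z in closedBall x r, ‖v z - v x‖ₑ ∂μ ≤ ENNReal.ofReal r * (lam * μ (closedBall x r)) := by
  refine (lintegral_enorm_sub_le μ hv x measurableSet_closedBall (D := ENNReal.ofReal r)
    fun z hz => ?_).trans ?_
  · rw [← ofReal_norm]
    exact ENNReal.ofReal_le_ofReal (by simpa [dist_eq_norm] using hz)
  · gcongr
    calc _ ≤ ∫⁻ s in Ioc (0 : ℝ) 1, lam * μ (closedBall x r) := by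
          refine setLIntegral_mono' measurableSet_Ioc fun s hs => ?_
          have hs0 : 0 < s ^ Module.finrank ℝ F := pow_pos hs.1 _
          calc _ ≤ (ENNReal.ofReal (s ^ Module.finrank ℝ F))⁻¹ *
                ∫⁻ y in closedBall x (s * r), ‖fderiv ℝ v y‖ₑ ∂μ := by
                gcongr
                exact image_homothety_closedBall_subset x hs.1.le
            _ ≤ (ENNReal.ofReal (s ^ Module.finrank ℝ F))⁻¹ *
                (lam * μ (closedBall x (s * r))) := by
                gcongr
                exact hM _ (mul_pos hs.1 hr) (mul_le_of_le_one_left hr.le hs.2)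
            _ = lam * μ (closedBall x r) := by
                rw [Measure.addHaar_closedBall_mul_of_pos μ x hs.1 r,
                  Measure.addHaar_closedBall_center μ x r, mul_left_comm lam, ← mul_assoc,
                  ENNReal.inv_mul_cancel (ENNReal.ofReal_pos.2 hs0).ne' ENNReal.ofReal_ne_top,
                  one_mul]
      _ = lam * μ (closedBall x r) := by simp

/-- A `C¹` function is Lipschitz between points where the maximal function of its derivative is
small. -/
theorem enorm_sub_le_of_maximal (μ : Measure F) [μ.IsAddHaarMeasure] {v : F → V}
    (hv : ContDiff ℝ 1 v) {x y : F} {lam : ℝ≥0∞}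
    (hx : ∀ ρ, 0 < ρ → ρ ≤ 1 →
      ∫⁻ z in closedBall x ρ, ‖fderiv ℝ v z‖ₑ ∂μ ≤ lam * μ (closedBall x ρ))
    (hy : ∀ ρ, 0 < ρ → ρ ≤ 1 →
      ∫⁻ z in closedBall y ρ, ‖fderiv ℝ v z‖ₑ ∂μ ≤ lam * μ (closedBall y ρ))
    (hxy : dist x y ≤ 1) :
    ‖v x - v y‖ₑ ≤ 2 ^ (Module.finrank ℝ F + 1) * lam * ENNReal.ofReal (dist x y) := by
  rcases eq_or_ne x y with rfl | hne
  · simp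
  set r := dist x y
  have hr : 0 < r := dist_pos.2 hne
  set m := midpoint ℝ x y
  have hmx : closedBall m (r / 2) ⊆ closedBall x r := closedBall_subset_closedBall' (by
    rw [dist_midpoint_left]
    simp only [Real.norm_ofNat]; change r / 2 + 2⁻¹ * r ≤ r; linarith)
  have hmy : closedBall m (r / 2) ⊆ closedBall y r := closedBall_subset_closedBall' (by
    rw [dist_midpoint_right]
    simp only [Real.norm_ofNat]; change r / 2 + 2⁻¹ * r ≤ r; linarith)
  have h1 := lintegral_closedBall_enorm_sub_le μ hv x hr fun ρ h0 h1 => hx ρ h0 (h1.trans hxy)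
  have h2 := lintegral_closedBall_enorm_sub_le μ hv y hr fun ρ h0 h1 => hy ρ h0 (h1.trans hxy)
  have hvol : ∀ z : F, μ (closedBall z r) = 2 ^ Module.finrank ℝ F * μ (closedBall m (r / 2)) := by
    intro z
    have h3 := Measure.addHaar_closedBall_mul_of_pos μ z (r := 2) two_pos (r / 2)
    rw [mul_div_cancel₀ r two_ne_zero] at h3
    rw [h3, Measure.addHaar_closedBall_center μ m, ENNReal.ofReal_pow zero_le_two]
    simp
  have hpos : μ (closedBall m (r / 2)) ≠ 0 := (measure_closedBall_pos μ m (by positivity)).ne'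
  have hfin : μ (closedBall m (r / 2)) ≠ ∞ := measure_closedBall_lt_top.ne
  have hvc : Continuous v := hv.continuous
  have key : ‖v x - v y‖ₑ * μ (closedBall m (r / 2)) ≤
      (2 ^ (Module.finrank ℝ F + 1) * lam * ENNReal.ofReal r) * μ (closedBall m (r / 2)) := by
    calc ‖v x - v y‖ₑ * μ (closedBall m (r / 2))
        = ∫⁻ _ in closedBall m (r / 2), ‖v x - v y‖ₑ ∂μ := by simp
      _ ≤ ∫⁻ z in closedBall m (r / 2), (‖v z - v x‖ₑ + ‖v z - v y‖ₑ) ∂μ := by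
          refine lintegral_mono fun z => ?_
          have : v x - v y = (v z - v y) - (v z - v x) := by abel
          rw [this, add_comm]
          exact enorm_sub_le
      _ = ∫⁻ z in closedBall m (r / 2), ‖v z - v x‖ₑ ∂μ
          + ∫⁻ z in closedBall m (r / 2), ‖v z - v y‖ₑ ∂μ := by
          refine lintegral_add_left' ?_ _
          have : Continuous fun z => ‖v z - v x‖ₑ := by fun_prop
          exact this.aemeasurable
      _ ≤ ENNReal.ofReal r * (lam * μ (closedBall x r))
          + ENNReal.ofReal r * (lam * μ (closedBall y r)) :=
          add_le_add ((lintegral_mono_set hmx).trans h1) ((lintegral_mono_set hmy).trans h2)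
      _ = _ := by rw [hvol x, hvol y, pow_succ]; ring
  exact (ENNReal.mul_le_mul_iff_left hpos hfin).1 key

/-- Weak type estimate for the local centred maximal function. -/
theorem measure_maximal_le (μ : Measure F) [μ.IsAddHaarMeasure] (h : F → ℝ≥0∞) {lam : ℝ≥0∞}
    (hlam : lam ≠ 0) (hlam' : lam ≠ ∞) :
    μ {x | ∃ ρ, 0 < ρ ∧ ρ ≤ 1 ∧ lam * μ (closedBall x ρ) < ∫⁻ z in closedBall x ρ, h z ∂μ}
      ≤ 4 ^ Module.finrank ℝ F * lam⁻¹ * ∫⁻ z, h z ∂μ := by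
  set t := {x | ∃ ρ, 0 < ρ ∧ ρ ≤ 1 ∧ lam * μ (closedBall x ρ) < ∫⁻ z in closedBall x ρ, h z ∂μ}
  have ht : ∀ x : F, ∃ ρ : ℝ, x ∈ t →
      0 < ρ ∧ ρ ≤ 1 ∧ lam * μ (closedBall x ρ) < ∫⁻ z in closedBall x ρ, h z ∂μ := fun x => by
    by_cases hx : x ∈ t
    · obtain ⟨ρ, hρ⟩ := hx; exact ⟨ρ, fun _ => hρ⟩
    · exact ⟨0, fun h => absurd h hx⟩
  choose ρ hρ using ht
  obtain ⟨u, hut, hdisj, hcov⟩ := Vitali.exists_disjoint_subfamily_covering_enlargement_closedBall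
    t id ρ 1 (fun x hx => (hρ x hx).2.1) 4 (by norm_num)
  have hcount : u.Countable := hdisj.countable_of_nonempty_interior fun x hx =>
    ⟨x, ball_subset_interior_closedBall (mem_ball_self (hρ x (hut hx)).1)⟩
  calc μ t ≤ μ (⋃ x ∈ u, closedBall x (4 * ρ x)) := by
        refine measure_mono fun x hx => ?_
        obtain ⟨b, hb, hsub⟩ := hcov x hx
        exact mem_biUnion hb (hsub (mem_closedBall_self (hρ x hx).1.le))
    _ ≤ ∑' x : u, μ (closedBall (x : F) (4 * ρ x)) := measure_biUnion_le μ hcount _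
    _ ≤ ∑' x : u, 4 ^ Module.finrank ℝ F * lam⁻¹ * ∫⁻ z in closedBall (x : F) (ρ x), h z ∂μ := by
        refine ENNReal.tsum_le_tsum fun x => ?_
        have h1 := (hρ x (hut x.2)).2.2.le
        rw [Measure.addHaar_closedBall_mul_of_pos μ _ (r := 4) (by norm_num),
          ← Measure.addHaar_closedBall_center μ (x : F), ENNReal.ofReal_pow (by norm_num),
          mul_assoc]
        have h4 : ENNReal.ofReal 4 = 4 := by norm_num
        rw [h4]
        gcongr
        calc μ (closedBall (x : F) (ρ x)) = lam⁻¹ * (lam * μ (closedBall (x : F) (ρ x))) := by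
              rw [← mul_assoc, ENNReal.inv_mul_cancel hlam hlam', one_mul]
          _ ≤ _ := by gcongr
    _ = 4 ^ Module.finrank ℝ F * lam⁻¹ * ∑' x : u, ∫⁻ z in closedBall (x : F) (ρ x), h z ∂μ :=
        ENNReal.tsum_mul_left
    _ = 4 ^ Module.finrank ℝ F * lam⁻¹ * ∫⁻ z in ⋃ x ∈ u, closedBall (x : F) (ρ x), h z ∂μ := by
        have hdisj' : u.PairwiseDisjoint fun a => closedBall a (ρ a) := hdisj
        rw [lintegral_biUnion hcount (fun _ _ => measurableSet_closedBall) hdisj']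
    _ ≤ _ := mul_le_mul_right (setLIntegral_le_lintegral _ _) _

end Estimates

section Morrey

/-- Jensen's inequality for powers, in the form given by Hölder's inequality. -/
theorem lintegral_rpow_le {α : Type*} [MeasurableSpace α] (ν : Measure α) {h : α → ℝ≥0∞}
    (hh : AEMeasurable h ν) {p : ℝ} (hp : 1 ≤ p) :
    (∫⁻ x, h x ∂ν) ^ p ≤ ν univ ^ (p - 1) * ∫⁻ x, h x ^ p ∂ν := by
  rcases hp.eq_or_lt with rfl | hp
  · simp
  have hq := Real.HolderConjugate.conjExponent hp
  have h1 := ENNReal.lintegral_mul_le_Lp_mul_Lq ν hq hh (aemeasurable_const (b := (1 : ℝ≥0∞)))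
  have hp0 : 0 < p := by linarith
  simp only [Pi.mul_apply, mul_one, ENNReal.one_rpow, lintegral_const, one_mul] at h1
  calc (∫⁻ x, h x ∂ν) ^ p
      ≤ ((∫⁻ x, h x ^ p ∂ν) ^ (1 / p) * ν univ ^ (1 / Real.conjExponent p)) ^ p :=
        ENNReal.rpow_le_rpow h1 hp0.le
    _ = _ := by
        rw [ENNReal.mul_rpow_of_nonneg _ _ hp0.le, ← ENNReal.rpow_mul, ← ENNReal.rpow_mul,
          one_div_mul_cancel hp0.ne', ENNReal.rpow_one, mul_comm]
        congr 2
        rw [Real.conjExponent]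
        have : p - 1 ≠ 0 := by linarith
        field_simp

theorem lintegral_Ioc_rpow_ne_top {a : ℝ} (ha : -1 < a) :
    ∫⁻ s in Ioc (0 : ℝ) 1, ENNReal.ofReal (s ^ a) ≠ ∞ := by
  have h1 : IntegrableOn (fun s : ℝ => s ^ a) (Ioc 0 1) := by
    have := intervalIntegral.intervalIntegrable_rpow' (a := 0) (b := 1) ha
    rwa [intervalIntegrable_iff_integrableOn_Ioc_of_le zero_le_one] at this
  exact ((lintegral_mono fun s => Real.ofReal_le_enorm _).trans_lt h1.2).ne

/-- If the mean oscillation around a point is controlled, so is the value at this point. -/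
theorem enorm_rpow_le_of_lintegral_sub_le {F V : Type*} [NormedAddCommGroup F] [NormedSpace ℝ F]
    [MeasurableSpace F] [BorelSpace F] [NormedAddCommGroup V] [NormedSpace ℝ V]
    (μ : Measure F) {Q : Set F} {p : ℝ} (hp : 1 ≤ p)
    (hμ0 : μ Q ≠ 0) (hμ : μ Q ≠ ∞) {v : F → V} (hv : Continuous v) {x : F} {A : ℝ≥0∞}
    (hA : (∫⁻ z in Q, ‖v z - v x‖ₑ ∂μ) ^ p ≤ A * ∫⁻ z in Q, ‖fderiv ℝ v z‖ₑ ^ p ∂μ) :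
    ‖v x‖ₑ ^ p ≤ (μ Q ^ p)⁻¹ * (2 ^ (p - 1) * (A + μ Q ^ (p - 1))) *
      ∫⁻ z in Q, (‖v z‖ₑ ^ p + ‖fderiv ℝ v z‖ₑ ^ p) ∂μ := by
  have hp0 : 0 ≤ p := by linarith
  have hv1 : Measurable fun z => ‖v z‖ₑ := hv.enorm.measurable
  have hv2 : Measurable fun z => ‖v z - v x‖ₑ := by
    have : Continuous fun z => ‖v z - v x‖ₑ := by fun_prop
    exact this.measurable
  set I := ∫⁻ z in Q, (‖v z‖ₑ ^ p + ‖fderiv ℝ v z‖ₑ ^ p) ∂μ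
  have h1 : (μ Q * ‖v x‖ₑ) ^ p ≤ 2 ^ (p - 1) * (A + μ Q ^ (p - 1)) * I := by
    calc (μ Q * ‖v x‖ₑ) ^ p = (∫⁻ z in Q, ‖v x‖ₑ ∂μ) ^ p := by
          rw [setLIntegral_const, mul_comm]
      _ ≤ (∫⁻ z in Q, (‖v z - v x‖ₑ + ‖v z‖ₑ) ∂μ) ^ p := by
          gcongr with z
          calc ‖v x‖ₑ = ‖v z - (v z - v x)‖ₑ := by congr 1; abel
            _ ≤ _ := by rw [add_comm]; exact enorm_sub_le
      _ = ((∫⁻ z in Q, ‖v z - v x‖ₑ ∂μ) + ∫⁻ z in Q, ‖v z‖ₑ ∂μ) ^ p := by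
          rw [lintegral_add_left hv2]
      _ ≤ 2 ^ (p - 1) * ((∫⁻ z in Q, ‖v z - v x‖ₑ ∂μ) ^ p + (∫⁻ z in Q, ‖v z‖ₑ ∂μ) ^ p) :=
          ENNReal.rpow_add_le_mul_rpow_add_rpow _ _ hp
      _ ≤ 2 ^ (p - 1) * (A * I + μ Q ^ (p - 1) * I) := by
          gcongr
          · refine hA.trans ?_
            gcongr
            exact lintegral_mono fun z => le_add_self
          · refine (lintegral_rpow_le (μ.restrict Q) hv1.aemeasurable hp).trans ?_
            rw [Measure.restrict_apply_univ]
            gcongr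
            exact lintegral_mono fun z => le_self_add
      _ = _ := by ring
  rw [ENNReal.mul_rpow_of_nonneg _ _ hp0] at h1
  have hm0 : μ Q ^ p ≠ 0 := by
    simp [ENNReal.rpow_eq_zero_iff, hμ0, hμ]
  have hm1 : μ Q ^ p ≠ ∞ := ENNReal.rpow_ne_top_of_nonneg hp0 hμ
  calc ‖v x‖ₑ ^ p = (μ Q ^ p)⁻¹ * (μ Q ^ p * ‖v x‖ₑ ^ p) := by
        rw [← mul_assoc, ENNReal.inv_mul_cancel hm0 hm1, one_mul]
    _ ≤ (μ Q ^ p)⁻¹ * (2 ^ (p - 1) * (A + μ Q ^ (p - 1)) * I) := by gcongr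
    _ = _ := by ring

variable {F V : Type*} [NormedAddCommGroup F] [NormedSpace ℝ F] [FiniteDimensional ℝ F]
  [MeasurableSpace F] [BorelSpace F] [NormedAddCommGroup V] [NormedSpace ℝ V] [CompleteSpace V]

/-- The constant produced by `enorm_rpow_le_of_lintegral_sub_le` is finite. -/
theorem oscillation_const_ne_top {m A : ℝ≥0∞} {p : ℝ} (hp : 1 ≤ p) (hm0 : m ≠ 0) (hm : m ≠ ∞)
    (hA : A ≠ ∞) : (m ^ p)⁻¹ * (2 ^ (p - 1) * (A + m ^ (p - 1))) ≠ ∞ := by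
  refine ENNReal.mul_ne_top ?_ (ENNReal.mul_ne_top ?_ (ENNReal.add_ne_top.2 ⟨hA, ?_⟩))
  · rw [ENNReal.inv_ne_top]
    simp [ENNReal.rpow_eq_zero_iff, hm0, hm]
  · exact ENNReal.rpow_ne_top_of_nonneg (by linarith) (by simp)
  · exact ENNReal.rpow_ne_top_of_nonneg (by linarith) hm

/-- Morrey's inequality on bounded convex sets. -/
theorem exists_morrey (μ : Measure F) [μ.IsAddHaarMeasure] {Q : Set F} (hQ : Convex ℝ Q)
    (hQm : MeasurableSet Q) (hQb : Bornology.IsBounded Q) (hQ0 : μ Q ≠ 0) {p : ℝ} (hp1 : 1 ≤ p)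
    (hp : (Module.finrank ℝ F : ℝ) < p) :
    ∃ C : ℝ≥0∞, C ≠ ∞ ∧ ∀ v : F → V, ContDiff ℝ 1 v → ∀ x ∈ Q,
      ‖v x‖ₑ ^ p ≤ C * ∫⁻ z in Q, (‖v z‖ₑ ^ p + ‖fderiv ℝ v z‖ₑ ^ p) ∂μ := by
  have hp0 : 0 < p := by linarith
  have hQt : μ Q ≠ ∞ := hQb.measure_lt_top.ne
  set d := Module.finrank ℝ F with hd
  set D : ℝ≥0∞ := ENNReal.ofReal (diam Q)
  set T : ℝ≥0∞ := ∫⁻ s in Ioc (0 : ℝ) 1, ENNReal.ofReal (s ^ (-(d / p : ℝ)))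
  have hT : T ≠ ∞ := lintegral_Ioc_rpow_ne_top (by
    rw [neg_lt_neg_iff, div_lt_one hp0]; exact hp)
  set A : ℝ≥0∞ := (D * T) ^ p * μ Q ^ (p - 1)
  have hA : A ≠ ∞ := ENNReal.mul_ne_top
    (ENNReal.rpow_ne_top_of_nonneg hp0.le (ENNReal.mul_ne_top ENNReal.ofReal_ne_top hT))
    (ENNReal.rpow_ne_top_of_nonneg (by linarith) hQt)
  refine ⟨_, oscillation_const_ne_top hp1 hQ0 hQt hA, fun v hv x hx =>
    enorm_rpow_le_of_lintegral_sub_le μ hp1 hQ0 hQt hv.continuous ?_⟩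
  set I := ∫⁻ z in Q, ‖fderiv ℝ v z‖ₑ ^ p ∂μ
  have hDv : Measurable fun z => ‖fderiv ℝ v z‖ₑ :=
    (hv.continuous_fderiv one_ne_zero).enorm.measurable
  have hcore := lintegral_enorm_sub_le μ hv x hQm (D := D) fun z hz => by
    rw [← ofReal_norm, ← dist_eq_norm]
    exact ENNReal.ofReal_le_ofReal (dist_le_diam_of_mem hQb hz hx)
  have hinner : ∀ s ∈ Ioc (0 : ℝ) 1, (ENNReal.ofReal (s ^ d))⁻¹ *
      ∫⁻ y in (fun z => x + s • (z - x)) '' Q, ‖fderiv ℝ v y‖ₑ ∂μ ≤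
      ENNReal.ofReal (s ^ (-(d / p : ℝ))) * (μ Q ^ (p - 1) * I) ^ (1 / p) := by
    intro s hs
    have hsub : (fun z => x + s • (z - x)) '' Q ⊆ Q := by
      rintro _ ⟨z, hz, rfl⟩
      exact hQ.add_smul_sub_mem hx hz ⟨hs.1.le, hs.2⟩
    have hsd : 0 < s ^ d := pow_pos hs.1 _
    have hvol : μ ((fun z => x + s • (z - x)) '' Q) = ENNReal.ofReal (s ^ d) * μ Q := by
      have : (fun z => x + s • (z - x)) '' Q = AffineMap.homothety x s '' Q := by
        congr 1; ext z; simp [AffineMap.homothety_apply, add_comm]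
      rw [this, Measure.addHaar_image_homothety, abs_of_pos hsd]
    have h1 := lintegral_rpow_le (μ.restrict ((fun z => x + s • (z - x)) '' Q))
      hDv.aemeasurable hp1
    rw [Measure.restrict_apply_univ, hvol, ENNReal.mul_rpow_of_nonneg _ _ (by linarith)] at h1
    have h2 : ∫⁻ y in (fun z => x + s • (z - x)) '' Q, ‖fderiv ℝ v y‖ₑ ∂μ ≤
        ENNReal.ofReal (s ^ (d * (p - 1) / p)) * (μ Q ^ (p - 1) * I) ^ (1 / p) := by
      have h3 := ENNReal.rpow_le_rpow (h1.trans (mul_le_mul_right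
        (lintegral_mono_set (μ := μ) (f := fun z => ‖fderiv ℝ v z‖ₑ ^ p) hsub) _))
        (one_div_nonneg.2 hp0.le)
      rw [← ENNReal.rpow_mul, mul_one_div_cancel hp0.ne', ENNReal.rpow_one, mul_assoc,
        ENNReal.mul_rpow_of_nonneg _ _ (one_div_nonneg.2 hp0.le)] at h3
      refine h3.trans (le_of_eq ?_)
      congr 1
      rw [← ENNReal.rpow_mul, ENNReal.ofReal_rpow_of_pos hsd, ← Real.rpow_natCast,
        ← Real.rpow_mul hs.1.le]
      congr 2
      ring
    refine (mul_le_mul_right h2 _).trans (le_of_eq ?_)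
    rw [← mul_assoc, ← ENNReal.ofReal_inv_of_pos hsd,
      ← ENNReal.ofReal_mul (inv_nonneg.2 hsd.le), ← Real.rpow_natCast, ← Real.rpow_neg hs.1.le,
      ← Real.rpow_add hs.1]
    congr 3
    field_simp
    ring
  have hout : ∫⁻ z in Q, ‖v z - v x‖ₑ ∂μ ≤ D * T * (μ Q ^ (p - 1) * I) ^ (1 / p) := by
    refine hcore.trans ?_
    rw [mul_assoc]
    refine mul_le_mul_right ((setLIntegral_mono' measurableSet_Ioc hinner).trans (le_of_eq ?_)) _
    rw [lintegral_mul_const]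
    fun_prop
  calc _ ≤ (D * T * (μ Q ^ (p - 1) * I) ^ (1 / p)) ^ p := ENNReal.rpow_le_rpow hout hp0.le
    _ = A * I := by
      rw [ENNReal.mul_rpow_of_nonneg _ _ hp0.le, ← ENNReal.rpow_mul, one_div_mul_cancel hp0.ne',
        ENNReal.rpow_one, mul_assoc]

/-- The one-dimensional Sobolev inequality on intervals. -/
theorem exists_morrey_fin_one (c : Fin 1 → ℝ) {r : ℝ} (hr : 0 < r) {p : ℝ} (hp : 1 ≤ p) :
    ∃ C : ℝ≥0∞, C ≠ ∞ ∧ ∀ v : (Fin 1 → ℝ) → V, ContDiff ℝ 1 v → ∀ x ∈ closedBall c r,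
      ‖v x‖ₑ ^ p ≤ C * ∫⁻ z in closedBall c r, (‖v z‖ₑ ^ p + ‖fderiv ℝ v z‖ₑ ^ p) := by
  have hp0 : 0 < p := by linarith
  set Q := closedBall c r
  have hQ0 : volume Q ≠ 0 := (measure_closedBall_pos volume c hr).ne'
  have hQt : volume Q ≠ ∞ := measure_closedBall_lt_top.ne
  have hA : volume Q ^ p * volume Q ^ (p - 1) ≠ ∞ := ENNReal.mul_ne_top
    (ENNReal.rpow_ne_top_of_nonneg hp0.le hQt)
    (ENNReal.rpow_ne_top_of_nonneg (by linarith) hQt)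
  refine ⟨_, oscillation_const_ne_top hp hQ0 hQt hA, fun v hv x hx =>
    enorm_rpow_le_of_lintegral_sub_le volume hp hQ0 hQt hv.continuous ?_⟩
  have hDc : Continuous (fderiv ℝ v) := hv.continuous_fderiv one_ne_zero
  have hDv : Measurable fun z => ‖fderiv ℝ v z‖ₑ := hDc.enorm.measurable
  have hpt : ∀ z ∈ Q, ‖v z - v x‖ₑ ≤ ∫⁻ y in Q, ‖fderiv ℝ v y‖ₑ := by
    intro z hz
    have hone : ‖(fun _ => 1 : Fin 1 → ℝ)‖ₑ = 1 := by
      rw [← ofReal_norm]; simp [pi_norm_const]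
    have hderiv : ∀ t : ℝ, HasDerivAt (fun t : ℝ => v fun _ => t)
        (fderiv ℝ v (fun _ => t) fun _ => 1) t := fun t => by
      have h2 : HasDerivAt (fun t : ℝ => (fun _ => t : Fin 1 → ℝ)) (fun _ => 1) t :=
        hasDerivAt_pi.2 fun _ => hasDerivAt_id t
      exact ((hv.differentiable one_ne_zero _).hasFDerivAt).comp_hasDerivAt t h2
    have hcont : Continuous fun t : ℝ => fderiv ℝ v (fun _ => t) fun _ => 1 := by fun_prop
    have h3 := intervalIntegral.integral_eq_sub_of_hasDerivAt (a := x 0) (b := z 0)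
      (fun s _ => hderiv s) (hcont.intervalIntegrable _ _)
    have hx0 : (fun _ => x 0) = x := by ext i; fin_cases i; rfl
    have hz0 : (fun _ => z 0) = z := by ext i; fin_cases i; rfl
    rw [hx0, hz0] at h3
    have hpre : (fun t : ℝ => (fun _ => t : Fin 1 → ℝ)) ⁻¹' Q = closedBall (c 0) r := by
      ext t
      simp [Q, closedBall_pi c hr.le, Real.dist_eq]
    calc ‖v z - v x‖ₑ = ‖∫ t in uIoc (x 0) (z 0), fderiv ℝ v (fun _ => t) fun _ => 1‖ₑ := by
          rw [← h3, ← ofReal_norm, ← ofReal_norm,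
            intervalIntegral.norm_intervalIntegral_eq]
      _ ≤ ∫⁻ t in uIoc (x 0) (z 0), ‖fderiv ℝ v (fun _ => t) fun _ => 1‖ₑ :=
          enorm_integral_le_lintegral_enorm _
      _ ≤ ∫⁻ t in uIoc (x 0) (z 0), ‖fderiv ℝ v fun _ => t‖ₑ := by
          refine lintegral_mono fun t => ?_
          simpa [hone] using ContinuousLinearMap.le_opENorm (fderiv ℝ v fun _ => t) fun _ => 1
      _ ≤ ∫⁻ t in (fun t : ℝ => (fun _ => t : Fin 1 → ℝ)) ⁻¹' Q, ‖fderiv ℝ v fun _ => t‖ₑ := by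
          refine lintegral_mono_set ?_
          have hxt : x 0 ∈ (fun t : ℝ => (fun _ => t : Fin 1 → ℝ)) ⁻¹' Q := by
            simpa [hx0] using hx
          have hzt : z 0 ∈ (fun t : ℝ => (fun _ => t : Fin 1 → ℝ)) ⁻¹' Q := by
            simpa [hz0] using hz
          rw [hpre, Real.closedBall_eq_Icc] at *
          exact uIoc_subset_uIcc.trans (uIcc_subset_Icc hxt hzt)
      _ = ∫⁻ y in Q, ‖fderiv ℝ v y‖ₑ :=
          (volume_preserving_funUnique (Fin 1) ℝ).symm.setLIntegral_comp_preimage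
            measurableSet_closedBall hDv
  calc (∫⁻ z in Q, ‖v z - v x‖ₑ) ^ p ≤ (∫⁻ z in Q, (∫⁻ y in Q, ‖fderiv ℝ v y‖ₑ)) ^ p :=
        ENNReal.rpow_le_rpow (setLIntegral_mono' measurableSet_closedBall hpt) hp0.le
    _ = volume Q ^ p * (∫⁻ y in Q, ‖fderiv ℝ v y‖ₑ) ^ p := by
        rw [setLIntegral_const, ENNReal.mul_rpow_of_nonneg _ _ hp0.le, mul_comm]
    _ ≤ volume Q ^ p * (volume Q ^ (p - 1) * ∫⁻ y in Q, ‖fderiv ℝ v y‖ₑ ^ p) := by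
        gcongr
        simpa using lintegral_rpow_le (volume.restrict Q) hDv.aemeasurable hp
    _ = _ := by ring

end Morrey

section Scheffe

variable {α W : Type*} [MeasurableSpace α] [NormedAddCommGroup W] {μ : Measure α}

/-- Scheffé's lemma: almost everywhere convergence without loss of mass is convergence in mean. -/
theorem tendsto_lintegral_enorm_sub_of_ae {a : ℕ → α → W} {b : α → W}
    (ha : ∀ k, AEStronglyMeasurable (a k) μ) (hb : AEStronglyMeasurable b μ)
    (hfin : ∫⁻ x, ‖b x‖ₑ ∂μ ≠ ∞) (hae : ∀ᵐ x ∂μ, Tendsto (fun k => a k x) atTop (𝓝 (b x)))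
    (hlim : ∀ ε : ℝ≥0∞, 0 < ε → ∀ᶠ k in atTop, ∫⁻ x, ‖a k x‖ₑ ∂μ ≤ ∫⁻ x, ‖b x‖ₑ ∂μ + ε) :
    Tendsto (fun k => ∫⁻ x, ‖a k x - b x‖ₑ ∂μ) atTop (𝓝 0) := by
  set B := ∫⁻ x, ‖b x‖ₑ ∂μ
  set ψ : ℕ → α → ℝ≥0∞ := fun k x => ‖a k x‖ₑ + ‖b x‖ₑ - ‖a k x - b x‖ₑ
  have hψm : ∀ k, AEMeasurable (ψ k) μ := fun k =>
    ((ha k).enorm.add hb.enorm).sub ((ha k).sub hb).enorm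
  have hψ : ∀ k, ∫⁻ x, ψ k x ∂μ + ∫⁻ x, ‖a k x - b x‖ₑ ∂μ = ∫⁻ x, ‖a k x‖ₑ ∂μ + B := fun k => by
    rw [← lintegral_add_left' (hψm k), ← lintegral_add_left' (ha k).enorm]
    exact lintegral_congr fun x => tsub_add_cancel_of_le enorm_sub_le
  have hliminf : B + B ≤ liminf (fun k => ∫⁻ x, ψ k x ∂μ) atTop := by
    refine le_trans (le_of_eq ?_) (lintegral_liminf_le' hψm)
    rw [← lintegral_add_left' hb.enorm]
    refine lintegral_congr_ae ?_
    filter_upwards [hae] with x hx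
    have h1 : Tendsto (fun k => ψ k x) atTop (𝓝 (‖b x‖ₑ + ‖b x‖ₑ - ‖b x - b x‖ₑ)) :=
      ENNReal.Tendsto.sub (hx.enorm.add tendsto_const_nhds) (hx.sub tendsto_const_nhds).enorm
        (Or.inl (by simp))
    rw [h1.liminf_eq]
    simp
  have hBB : B + B ≠ ∞ := ENNReal.add_ne_top.2 ⟨hfin, hfin⟩
  rw [ENNReal.tendsto_nhds_zero]
  intro ε hε
  have hε2 : 0 < ε / 2 := ENNReal.half_pos hε.ne'
  have h1 : ∀ᶠ k in atTop, B + B ≤ ∫⁻ x, ψ k x ∂μ + ε / 2 := by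
    rcases le_or_gt (B + B) (ε / 2) with h | h
    · exact Eventually.of_forall fun k => h.trans le_add_self
    · have h2 : B + B - ε / 2 < liminf (fun k => ∫⁻ x, ψ k x ∂μ) atTop :=
        lt_of_lt_of_le (ENNReal.sub_lt_self hBB (hε2.trans h).ne' hε2.ne') hliminf
      filter_upwards [eventually_lt_of_lt_liminf h2] with k hk
      exact tsub_le_iff_right.1 hk.le
  filter_upwards [h1, hlim _ hε2] with k hk1 hk2
  refine (ENNReal.add_le_add_iff_left hBB).1 ?_
  calc B + B + ∫⁻ x, ‖a k x - b x‖ₑ ∂μ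
      ≤ ∫⁻ x, ψ k x ∂μ + ε / 2 + ∫⁻ x, ‖a k x - b x‖ₑ ∂μ := by gcongr
    _ = ∫⁻ x, ‖a k x‖ₑ ∂μ + B + ε / 2 := by rw [← hψ k]; ring
    _ ≤ B + ε / 2 + B + ε / 2 := by gcongr
    _ = B + B + (ε / 2 + ε / 2) := by ring
    _ = B + B + ε := by rw [ENNReal.add_halves]

end Scheffe

section WeakDeriv

variable {E V : Type*} [NormedAddCommGroup E] [InnerProductSpace ℝ E] [FiniteDimensional ℝ E]
  [MeasurableSpace E] [BorelSpace E] [NormedAddCommGroup V] [NormedSpace ℝ V]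

/-- `u` is continuous with compact support, and `Du` is its integrable weak derivative. -/
structure HasWeakFDeriv (u : E → V) (Du : E → E →L[ℝ] V) : Prop where
  continuous : Continuous u
  hasCompactSupport : HasCompactSupport u
  integrable : Integrable Du
  integral_fderiv_smul : ∀ φ : E → ℝ, ContDiff ℝ (⊤ : ℕ∞) φ → HasCompactSupport φ →
    ∀ v : E, ∫ x, fderiv ℝ φ x v • u x = -∫ x, φ x • Du x v

theorem lintegral_enorm_normed_convolution_rpow_le {W : Type*} [NormedAddCommGroup W]
    [NormedSpace ℝ W] (ρ : ContDiffBump (0 : E)) {w : E → W} (hw : AEStronglyMeasurable w)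
    {p : ℝ} (hp : 1 ≤ p) :
    ∫⁻ x, ‖(convolution (ρ.normed volume) w (ContinuousLinearMap.lsmul ℝ ℝ) volume) x‖ₑ ^ p ≤
      ∫⁻ x, ‖w x‖ₑ ^ p := by
  rw [convolution_congr (ContinuousLinearMap.lsmul ℝ ℝ) (ae_eq_refl (ρ.normed volume)) hw.ae_eq_mk,
    lintegral_congr_ae (hw.ae_eq_mk.mono fun x hx => by
      simp only [hx] : (fun x => ‖w x‖ₑ ^ p) =ᵐ[volume] fun x => ‖hw.mk w x‖ₑ ^ p)]
  set w' := hw.mk w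
  have hw' : Measurable fun x => ‖w' x‖ₑ := hw.stronglyMeasurable_mk.enorm
  have hρm : Measurable fun t => ENNReal.ofReal (ρ.normed volume t) :=
    (ENNReal.continuous_ofReal.comp ρ.continuous_normed).measurable
  have hp0 : 0 ≤ p := by linarith
  set ν : Measure E := volume.withDensity fun t => ENNReal.ofReal (ρ.normed volume t)
  have hν : ν univ = 1 := by
    rw [withDensity_apply _ MeasurableSet.univ, Measure.restrict_univ,
      ← ofReal_integral_eq_lintegral_ofReal ρ.integrable_normed
        (Eventually.of_forall ρ.nonneg_normed), ρ.integral_normed, ENNReal.ofReal_one]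
  have : IsProbabilityMeasure ν := ⟨hν⟩
  have hpt : ∀ x, ‖(convolution (ρ.normed volume) w' (ContinuousLinearMap.lsmul ℝ ℝ) volume) x‖ₑ ^ p
      ≤ ∫⁻ t, ‖w' (x - t)‖ₑ ^ p ∂ν := fun x => by
    have hmx : Measurable fun t => ‖w' (x - t)‖ₑ := hw'.comp (measurable_const.sub measurable_id)
    have h1 := lintegral_rpow_le ν hmx.aemeasurable hp
    rw [hν, ENNReal.one_rpow, one_mul] at h1
    refine le_trans (ENNReal.rpow_le_rpow ?_ hp0) h1
    rw [lintegral_withDensity_eq_lintegral_mul _ hρm hmx]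
    refine (enorm_integral_le_lintegral_enorm _).trans (lintegral_mono fun t => ?_)
    rw [ContinuousLinearMap.lsmul_apply, enorm_smul, Pi.mul_apply,
      Real.enorm_of_nonneg (ρ.nonneg_normed t)]
  calc _ ≤ ∫⁻ x, ∫⁻ t, ‖w' (x - t)‖ₑ ^ p ∂ν := lintegral_mono hpt
    _ = ∫⁻ t, (∫⁻ x, ‖w' (x - t)‖ₑ ^ p) ∂ν := by
        refine lintegral_lintegral_swap (Measurable.aemeasurable ?_)
        exact (hw'.comp (measurable_fst.sub measurable_snd)).pow_const p
    _ = ∫⁻ t, (∫⁻ x, ‖w' x‖ₑ ^ p) ∂ν :=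
        lintegral_congr fun t => lintegral_sub_right_eq_self (fun x => ‖w' x‖ₑ ^ p) t
    _ = _ := by simp

namespace HasWeakFDeriv

variable {u w : E → V} {Du Dw : E → E →L[ℝ] V}

theorem fderiv_convolution [CompleteSpace V] (hu : HasWeakFDeriv u Du) {ρ : E → ℝ}
    (hρ : ContDiff ℝ (⊤ : ℕ∞) ρ) (hρc : HasCompactSupport ρ) (x : E) :
    fderiv ℝ (convolution ρ u (ContinuousLinearMap.lsmul ℝ ℝ) volume) x =
      convolution ρ Du (ContinuousLinearMap.lsmul ℝ ℝ) volume x := by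
  have hρ1 : ContDiff ℝ 1 ρ := hρ.of_le (by exact_mod_cast le_top)
  have hloc : LocallyIntegrable u := hu.continuous.locallyIntegrable
  rw [(hρc.hasFDerivAt_convolution_left (ContinuousLinearMap.lsmul ℝ ℝ) hρ1 hloc x).fderiv]
  ext v
  have hex1 := (hρc.fderiv ℝ).convolutionExists_left
    ((ContinuousLinearMap.lsmul ℝ ℝ : ℝ →L[ℝ] V →L[ℝ] V).precompL E)
    (hρ1.continuous_fderiv one_ne_zero) hloc x
  have hex2 := hρc.convolutionExists_left
    (ContinuousLinearMap.lsmul ℝ ℝ : ℝ →L[ℝ] (E →L[ℝ] V) →L[ℝ] (E →L[ℝ] V))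
    hρ.continuous hu.integrable.locallyIntegrable x
  rw [convolution_def, convolution_def, ContinuousLinearMap.integral_apply hex1,
    ContinuousLinearMap.integral_apply hex2]
  simp only [ContinuousLinearMap.precompL_apply, ContinuousLinearMap.lsmul_apply,
    _root_.smul_apply]
  have hφ : ContDiff ℝ (⊤ : ℕ∞) fun t => ρ (x - t) := hρ.comp (contDiff_const.sub contDiff_id)
  have hφc : HasCompactSupport fun t => ρ (x - t) :=
    hρc.comp_homeomorph (Homeomorph.subLeft x)
  have hfd : ∀ t, fderiv ℝ (fun t => ρ (x - t)) t v = -fderiv ℝ ρ (x - t) v := fun t => by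
    have h1 : HasFDerivAt (fun t => x - t) (-ContinuousLinearMap.id ℝ E) t :=
      (hasFDerivAt_id t).const_sub x
    have h2 := ((hρ1.differentiable one_ne_zero (x - t)).hasFDerivAt).comp t h1
    rw [show (fun t => ρ (x - t)) = ρ ∘ fun t => x - t from rfl, h2.fderiv]
    simp
  have key := hu.integral_fderiv_smul _ hφ hφc v
  simp only [hfd, neg_smul, integral_neg, neg_inj] at key
  have e1 := integral_sub_left_eq_self (fun t => fderiv ℝ ρ (x - t) v • u t) volume x
  have e2 := integral_sub_left_eq_self (fun t => ρ (x - t) • Du t v) volume x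
  simp only [sub_sub_cancel] at e1 e2
  rw [e1, e2, key]

/-- Approximation of weakly differentiable functions by mollification. -/
theorem exists_approx [CompleteSpace V] (hu : HasWeakFDeriv u Du) :
    ∃ U : ℕ → E → V, (∀ j, ContDiff ℝ 1 (U j)) ∧ TendstoUniformly U u atTop ∧
      (∀ j, ∀ p : ℝ, 1 ≤ p → ∫⁻ x, ‖U j x‖ₑ ^ p ≤ ∫⁻ x, ‖u x‖ₑ ^ p) ∧
      (∀ j, ∀ p : ℝ, 1 ≤ p → ∫⁻ x, ‖fderiv ℝ (U j) x‖ₑ ^ p ≤ ∫⁻ x, ‖Du x‖ₑ ^ p) ∧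
      Tendsto (fun j => ∫⁻ x, ‖fderiv ℝ (U j) x - Du x‖ₑ) atTop (𝓝 0) := by
  let ρ : ℕ → ContDiffBump (0 : E) := fun j =>
    ⟨1 / ((j : ℝ) + 1), 2 * (1 / ((j : ℝ) + 1)), by positivity, by
      have : 0 < 1 / ((j : ℝ) + 1) := by positivity
      linarith⟩
  have hrOut : Tendsto (fun j => (ρ j).rOut) atTop (𝓝 0) := by
    have := (tendsto_one_div_add_atTop_nhds_zero_nat (𝕜 := ℝ)).const_mul 2
    rwa [mul_zero] at this
  have hloc : LocallyIntegrable u := hu.continuous.locallyIntegrable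
  set U : ℕ → E → V := fun j =>
    convolution ((ρ j).normed volume) u (ContinuousLinearMap.lsmul ℝ ℝ) volume
  have hUd : ∀ j, fderiv ℝ (U j) =
      convolution ((ρ j).normed volume) Du (ContinuousLinearMap.lsmul ℝ ℝ) volume := fun j =>
    funext fun x => hu.fderiv_convolution (ρ j).contDiff_normed (ρ j).hasCompactSupport_normed x
  have hUs : ∀ j, ContDiff ℝ 1 (U j) := fun j =>
    (ρ j).hasCompactSupport_normed.contDiff_convolution_left (n := 1) _ (ρ j).contDiff_normed hloc
  have hDle : ∀ j, ∀ p : ℝ, 1 ≤ p → ∫⁻ x, ‖fderiv ℝ (U j) x‖ₑ ^ p ≤ ∫⁻ x, ‖Du x‖ₑ ^ p :=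
    fun j p hp => by
      rw [hUd j]
      exact lintegral_enorm_normed_convolution_rpow_le (ρ j) hu.integrable.aestronglyMeasurable hp
  refine ⟨U, hUs, ?_, fun j p hp => lintegral_enorm_normed_convolution_rpow_le (ρ j)
    hu.continuous.aestronglyMeasurable hp, hDle, ?_⟩
  · have huc := hu.hasCompactSupport.uniformContinuous_of_continuous hu.continuous
    rw [Metric.tendstoUniformly_iff]
    intro ε hε
    obtain ⟨δ, hδ, hδε⟩ := Metric.uniformContinuous_iff.1 huc (ε / 2) (half_pos hε)
    filter_upwards [hrOut.eventually_lt_const hδ] with j hj x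
    rw [dist_comm]
    refine lt_of_le_of_lt ((ρ j).dist_normed_convolution_le hu.continuous.aestronglyMeasurable
      fun y hy => (hδε (lt_trans hy hj)).le) (half_lt_self hε)
  · refine tendsto_lintegral_enorm_sub_of_ae
      (fun j => ((hUs j).continuous_fderiv one_ne_zero).aestronglyMeasurable)
      hu.integrable.aestronglyMeasurable hu.integrable.2.ne ?_
      fun ε _ => Eventually.of_forall fun j => le_add_right ?_
    · filter_upwards [ContDiffBump.ae_convolution_tendsto_right_of_locallyIntegrable (μ := volume)
        (φ := ρ) (K := 2) hrOut (Eventually.of_forall fun j => le_rfl)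
        hu.integrable.locallyIntegrable] with x hx
      simpa only [hUd] using hx
    · simpa using hDle j 1 le_rfl

theorem sub (hu : HasWeakFDeriv u Du) (hw : HasWeakFDeriv w Dw) :
    HasWeakFDeriv (fun x => u x - w x) (fun x => Du x - Dw x) where
  continuous := hu.continuous.sub hw.continuous
  hasCompactSupport := hu.hasCompactSupport.sub hw.hasCompactSupport
  integrable := hu.integrable.sub hw.integrable
  integral_fderiv_smul φ hφ hφc v := by
    have hφ1 : ContDiff ℝ 1 φ := hφ.of_le (by exact_mod_cast le_top)
    have hc : Continuous fun x => fderiv ℝ φ x v :=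
      (hφ1.continuous_fderiv one_ne_zero).clm_apply continuous_const
    have i1 : ∀ {a : E → V}, Continuous a → HasCompactSupport a →
        Integrable fun x => fderiv ℝ φ x v • a x := fun ha hac =>
      (hc.smul ha).integrable_of_hasCompactSupport hac.smul_left
    have i2 : ∀ {a : E → E →L[ℝ] V}, Integrable a → Integrable fun x => φ x • a x v := by
      intro a ha
      obtain ⟨C, hC⟩ := hφc.exists_bound_of_continuous hφ.continuous
      exact (ha.apply_continuousLinearMap v).bdd_smul C
        hφ.continuous.aestronglyMeasurable (Eventually.of_forall hC)
    simp only [smul_sub, _root_.sub_apply]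
    rw [integral_sub (i1 hu.continuous hu.hasCompactSupport)
      (i1 hw.continuous hw.hasCompactSupport), integral_sub (i2 hu.integrable) (i2 hw.integrable),
      hu.integral_fderiv_smul φ hφ hφc v, hw.integral_fderiv_smul φ hφ hφc v]
    abel

end HasWeakFDeriv

end WeakDeriv

section Cutoff

variable {E V : Type*} [NormedAddCommGroup E] [InnerProductSpace ℝ E] [FiniteDimensional ℝ E]
  [MeasurableSpace E] [BorelSpace E] [NormedAddCommGroup V] [NormedSpace ℝ V]
  {Ω : Set E} {u : E → V} {Du : E → E →L[ℝ] V} {χ : E → ℝ}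

theorem continuous_of_continuousOn_of_tsupport_subset {X W : Type*} [TopologicalSpace X]
    [TopologicalSpace W] [Zero W] {s : Set X} (hs : IsOpen s) {a : X → W} (ha : ContinuousOn a s)
    (hsupp : tsupport a ⊆ s) : Continuous a :=
  continuous_of_tsupport fun _ hx => ha.continuousAt (hs.mem_nhds (hsupp hx))

theorem integrable_of_integrableOn_of_support_subset {α W : Type*} [MeasurableSpace α]
    {μ : Measure α} [NormedAddCommGroup W] {a : α → W} {s : Set α} (ha : IntegrableOn a s μ)
    (hs : Function.support a ⊆ s) : Integrable a μ :=
  (integrableOn_iff_integrable_of_support_subset hs).1 ha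

theorem integrable_add_apply {α W : Type*} [MeasurableSpace α] {μ : Measure α}
    [NormedAddCommGroup W] {a b : α → W} (ha : Integrable a μ) (hb : Integrable b μ) :
    Integrable (fun x => a x + b x) μ :=
  ha.add hb

/-- A cutoff of a continuous weakly differentiable map has a global weak derivative. -/
theorem hasWeakFDeriv_smul_cutoff (hΩ : IsOpen Ω) (hDu : LocallyIntegrableOn Du Ω)
    (hibp : ∀ φ : E → ℝ, ContDiff ℝ (⊤ : ℕ∞) φ → HasCompactSupport φ → tsupport φ ⊆ Ω →
      ∀ v : E, ∫ x in Ω, fderiv ℝ φ x v • u x = - ∫ x in Ω, φ x • Du x v)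
    (huc : ContinuousOn u Ω) (hχ : ContDiff ℝ (⊤ : ℕ∞) χ) (hχc : HasCompactSupport χ)
    (hχΩ : tsupport χ ⊆ Ω) :
    HasWeakFDeriv (fun x => χ x • u x)
      (fun x => χ x • Du x + (fderiv ℝ χ x).smulRight (u x)) := by
  have hχ1 : ContDiff ℝ 1 χ := hχ.of_le (by exact_mod_cast le_top)
  have hDχ : Continuous (fderiv ℝ χ) := hχ1.continuous_fderiv one_ne_zero
  have hDχΩ : tsupport (fderiv ℝ χ) ⊆ Ω := (tsupport_fderiv_subset ℝ).trans hχΩ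
  have hcu : Continuous fun x => χ x • u x :=
    continuous_of_continuousOn_of_tsupport_subset hΩ (hχ.continuous.continuousOn.smul huc)
      ((tsupport_smul_subset_left χ u).trans hχΩ)
  have hsuppR : tsupport (fun x => (fderiv ℝ χ x).smulRight (u x)) ⊆ tsupport (fderiv ℝ χ) :=
    closure_mono fun x hx h => hx (by
      simp only [h]; ext; simp)
  have hcR : Continuous fun x => (fderiv ℝ χ x).smulRight (u x) := by
    refine continuous_of_continuousOn_of_tsupport_subset hΩ ?_ (hsuppR.trans hDχΩ)
    exact ((ContinuousLinearMap.smulRightL ℝ E V).continuous.comp_continuousOn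
      hDχ.continuousOn).clm_apply huc
  have hiR : Integrable fun x => (fderiv ℝ χ x).smulRight (u x) :=
    hcR.integrable_of_hasCompactSupport
      ((hχc.fderiv ℝ).isCompact.of_isClosed_subset (isClosed_tsupport _) hsuppR)
  obtain ⟨C, hC⟩ := hχc.exists_bound_of_continuous hχ.continuous
  have hiD : Integrable fun x => χ x • Du x := by
    have h1 : IntegrableOn Du (tsupport χ) :=
      hDu.integrableOn_compact_subset hχΩ hχc.isCompact
    have h2 : IntegrableOn (fun x => χ x • Du x) (tsupport χ) :=
      Integrable.bdd_smul (φ := χ) h1 C hχ.continuous.aestronglyMeasurable (Eventually.of_forall hC)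
    exact integrable_of_integrableOn_of_support_subset h2 fun x hx =>
      subset_tsupport _ fun h => hx (by simp only [h, zero_smul])
  refine ⟨hcu, hχc.smul_right, integrable_add_apply hiD hiR, fun φ hφ hφc v => ?_⟩
  have hφ1 : ContDiff ℝ 1 φ := hφ.of_le (by exact_mod_cast le_top)
  have hzero : ∀ x ∉ Ω, χ x = 0 := fun x hx =>
    image_eq_zero_of_notMem_tsupport fun h => hx (hχΩ h)
  have hDzero : ∀ x ∉ Ω, fderiv ℝ χ x = 0 := fun x hx =>
    image_eq_zero_of_notMem_tsupport fun h => hx (hDχΩ h)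
  have hfd : ∀ x, fderiv ℝ (fun x => φ x * χ x) x v =
      φ x * fderiv ℝ χ x v + χ x * fderiv ℝ φ x v := fun x => by
    rw [fderiv_fun_mul (hφ1.differentiable one_ne_zero x) (hχ1.differentiable one_ne_zero x)]
    simp
  have key := hibp (fun x => φ x * χ x) (hφ.mul hχ) hχc.mul_left
    ((tsupport_mul_subset_right).trans hχΩ) v
  rw [setIntegral_eq_integral_of_forall_compl_eq_zero (fun x hx => by
      simp [hfd, hzero x hx, hDzero x hx]),
    setIntegral_eq_integral_of_forall_compl_eq_zero (fun x hx => by simp [hzero x hx])] at key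
  have hcv : Continuous fun x => fderiv ℝ φ x v :=
    (hφ1.continuous_fderiv one_ne_zero).clm_apply continuous_const
  have i1 : Integrable fun x => fderiv ℝ φ x v • χ x • u x :=
    (hcv.smul hcu).integrable_of_hasCompactSupport (hχc.smul_right.smul_left)
  obtain ⟨C', hC'⟩ := hφc.exists_bound_of_continuous hφ.continuous
  have i2 : Integrable fun x => φ x • (fderiv ℝ χ x).smulRight (u x) v :=
    (hiR.apply_continuousLinearMap v).bdd_smul C' hφ.continuous.aestronglyMeasurable
      (Eventually.of_forall hC')
  have i3 : Integrable fun x => φ x • (χ x • Du x) v :=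
    (hiD.apply_continuousLinearMap v).bdd_smul C' hφ.continuous.aestronglyMeasurable
      (Eventually.of_forall hC')
  have e1 : ∫ x, fderiv ℝ (fun x => φ x * χ x) x v • u x =
      (∫ x, φ x • (fderiv ℝ χ x).smulRight (u x) v) + ∫ x, fderiv ℝ φ x v • χ x • u x := by
    rw [← integral_add i2 i1]
    refine integral_congr_ae (Eventually.of_forall fun x => ?_)
    simp only [hfd, add_smul, mul_smul, ContinuousLinearMap.smulRight_apply]
    rw [smul_comm (χ x)]
  have e2 : ∫ x, (φ x * χ x) • Du x v = ∫ x, φ x • (χ x • Du x) v := by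
    simp only [mul_smul, _root_.smul_apply]
  rw [e1, e2] at key
  simp only [_root_.add_apply, smul_add]
  rw [integral_add i3 i2, neg_add, ← key]
  abel

theorem HasWeakDerivOn.smul_cutoff {Ω : Set (Em n)} {u : Em n → Em n}
    {Du : Em n → Em n →L[ℝ] Em n} {χ : Em n → ℝ} (hu : HasWeakDerivOn u Du Ω) (hΩ : IsOpen Ω)
    (huc : ContinuousOn u Ω) (hχ : ContDiff ℝ (⊤ : ℕ∞) χ) (hχc : HasCompactSupport χ)
    (hχΩ : tsupport χ ⊆ Ω) :
    HasWeakFDeriv (fun x => χ x • u x)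
      (fun x => χ x • Du x + (fderiv ℝ χ x).smulRight (u x)) :=
  hasWeakFDeriv_smul_cutoff hΩ hu.2.1 hu.2.2 huc hχ hχc hχΩ

end Cutoff

section Differentiability

variable {E V : Type*} [NormedAddCommGroup E] [InnerProductSpace ℝ E] [FiniteDimensional ℝ E]
  [MeasurableSpace E] [BorelSpace E] [NormedAddCommGroup V] [NormedSpace ℝ V]

/-- A limit of `C¹` functions whose derivatives converge fast outside of summable bad sets is
differentiable along the good sets. -/
theorem hasFDerivWithinAt_of_geometric {G : Type*} [NormedAddCommGroup G] [NormedSpace ℝ G]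
    {w : ℕ → G → V} {u : G → V} {Du : G → G →L[ℝ] V} {A : Set G} {M : ℝ} {j : ℕ}
    (hw : ∀ l, Differentiable ℝ (w l)) (hlim : ∀ x, Tendsto (fun l => w l x) atTop (𝓝 (u x)))
    (hlip : ∀ l ≥ j, ∀ x ∈ A, ∀ y ∈ A, dist x y ≤ 1 →
      ‖(w (l + 1) x - w l x) - (w (l + 1) y - w l y)‖ ≤ M * (1 / 2) ^ l * dist x y)
    (hD : ∀ l ≥ j, ∀ x ∈ A, ‖fderiv ℝ (w l) x - Du x‖ ≤ (1 / 2) ^ l) {x : G} (hx : x ∈ A) :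
    HasFDerivWithinAt u (Du x) A x := by
  have hrem : ∀ k ≥ j, ∀ y ∈ A, dist y x ≤ 1 →
      ‖(w k y - w k x) - (u y - u x)‖ ≤ 2 * M * (1 / 2) ^ k * dist y x := by
    intro k hk y hy hyx
    have h1 : ∀ m, dist (w (k + m) y - w (k + m) x) (w (k + (m + 1)) y - w (k + (m + 1)) x) ≤
        2 * M * (1 / 2) ^ k * dist y x / 2 / 2 ^ m := fun m => by
      have h2 := hlip (k + m) (le_add_right hk) y hy x hx hyx
      rw [dist_comm, dist_eq_norm]
      calc _ = ‖(w (k + m + 1) y - w (k + m) y) - (w (k + m + 1) x - w (k + m) x)‖ := by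
            congr 1; rw [← add_assoc]; abel
        _ ≤ _ := h2
        _ = _ := by rw [pow_add, one_div_pow (2 : ℝ) m]; field_simp
    have h3 : Tendsto (fun m => w (k + m) y - w (k + m) x) atTop (𝓝 (u y - u x)) := by
      have := ((hlim y).sub (hlim x)).comp (tendsto_add_atTop_nat k)
      simpa [Function.comp_def, add_comm] using this
    have h4 := dist_le_of_le_geometric_two_of_tendsto₀ h1 h3
    rwa [dist_eq_norm] at h4
  rw [hasFDerivWithinAt_iff_isLittleO, Asymptotics.isLittleO_iff]
  intro c hc
  have hpow : Tendsto (fun k : ℕ => ((1 : ℝ) / 2) ^ k) atTop (𝓝 0) :=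
    tendsto_pow_atTop_nhds_zero_of_lt_one (by norm_num) (by norm_num)
  have hpow' : Tendsto (fun k : ℕ => 2 * M * ((1 : ℝ) / 2) ^ k) atTop (𝓝 0) := by
    simpa using hpow.const_mul (2 * M)
  have hc3 : 0 < c / 3 := by positivity
  obtain ⟨k, hk1, hk2, hkj⟩ := ((hpow.eventually_lt_const hc3).and
    ((hpow'.eventually_lt_const hc3).and (eventually_ge_atTop j))).exists
  have hwk := (hw k x).hasFDerivAt.hasFDerivWithinAt (s := A)
  rw [hasFDerivWithinAt_iff_isLittleO, Asymptotics.isLittleO_iff] at hwk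
  have hball : ∀ᶠ y in 𝓝[A] x, dist y x ≤ 1 :=
    mem_nhdsWithin_of_mem_nhds (closedBall_mem_nhds x one_pos)
  filter_upwards [hwk hc3, self_mem_nhdsWithin, hball] with y hy hyA hyx
  have e1 := hrem k hkj y hyA hyx
  have e2 : ‖(fderiv ℝ (w k) x - Du x) (y - x)‖ ≤ c / 3 * ‖y - x‖ :=
    (ContinuousLinearMap.le_opNorm _ _).trans
      (mul_le_mul_of_nonneg_right ((hD k hkj x hx).trans hk1.le) (norm_nonneg _))
  have e3 : 2 * M * (1 / 2) ^ k * dist y x ≤ c / 3 * ‖y - x‖ := by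
    rw [← dist_eq_norm]
    exact mul_le_mul_of_nonneg_right hk2.le dist_nonneg
  calc ‖u y - u x - Du x (y - x)‖
      = ‖(w k y - w k x - fderiv ℝ (w k) x (y - x)) - ((w k y - w k x) - (u y - u x))
          + (fderiv ℝ (w k) x - Du x) (y - x)‖ := by
        congr 1; rw [_root_.sub_apply]; abel
    _ ≤ ‖w k y - w k x - fderiv ℝ (w k) x (y - x)‖ + ‖(w k y - w k x) - (u y - u x)‖
          + ‖(fderiv ℝ (w k) x - Du x) (y - x)‖ :=
        (norm_add_le _ _).trans (by gcongr; exact norm_sub_le _ _)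
    _ ≤ c / 3 * ‖y - x‖ + c / 3 * ‖y - x‖ + c / 3 * ‖y - x‖ := by
        gcongr
        exact e1.trans e3
    _ = c * ‖y - x‖ := by ring

/-- Weakly differentiable functions are differentiable along countably many measurable sets which
cover the space up to a null set. -/
theorem HasWeakFDeriv.exists_hasFDerivWithinAt [CompleteSpace V] {u : E → V}
    {Du : E → E →L[ℝ] V} (hu : HasWeakFDeriv u Du) :
    ∃ A : ℕ → Set E, (∀ j, MeasurableSet (A j)) ∧ volume (⋃ j, A j)ᶜ = 0 ∧
      ∀ j, ∀ x ∈ A j, HasFDerivWithinAt u (Du x) (A j) x := by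
  obtain ⟨U, hU1, hUu, -, -, hUD⟩ := hu.exists_approx
  have hsel : ∀ l : ℕ, ∃ j, l ≤ j ∧ ∫⁻ x, ‖fderiv ℝ (U j) x - Du x‖ₑ ≤ (8⁻¹ : ℝ≥0∞) ^ l := by
    intro l
    have hpos : (0 : ℝ≥0∞) < 8⁻¹ ^ l := ENNReal.pow_pos (by simp) l
    obtain ⟨j, hj1, hj2⟩ := ((ENNReal.tendsto_nhds_zero.1 hUD _ hpos).and
      (eventually_ge_atTop l)).exists
    exact ⟨j, hj2, hj1⟩
  choose J hJ hJD using hsel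
  set w : ℕ → E → V := fun l => U (J l)
  have hJt : Tendsto J atTop atTop := tendsto_atTop_mono hJ tendsto_id
  have hwu : ∀ x, Tendsto (fun l => w l x) atTop (𝓝 (u x)) := fun x =>
    (hUu.tendsto_at x).comp hJt
  have hw1 : ∀ l, ContDiff ℝ 1 (w l) := fun l => hU1 _
  have hDc : ∀ l, Continuous (fderiv ℝ (w l)) := fun l => (hw1 l).continuous_fderiv one_ne_zero
  set d := Module.finrank ℝ E
  set v : ℕ → E → V := fun l x => w (l + 1) x - w l x
  have hv1 : ∀ l, ContDiff ℝ 1 (v l) := fun l => (hw1 _).sub (hw1 _)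
  have hDv : ∀ l, ∫⁻ x, ‖fderiv ℝ (v l) x‖ₑ ≤ 2 * 8⁻¹ ^ l := by
    intro l
    calc ∫⁻ x, ‖fderiv ℝ (v l) x‖ₑ
        ≤ ∫⁻ x, (‖fderiv ℝ (w (l + 1)) x - Du x‖ₑ + ‖fderiv ℝ (w l) x - Du x‖ₑ) := by
          refine lintegral_mono fun x => ?_
          rw [fderiv_fun_sub ((hw1 _).differentiable one_ne_zero x)
            ((hw1 _).differentiable one_ne_zero x)]
          calc _ = ‖(fderiv ℝ (w (l + 1)) x - Du x) - (fderiv ℝ (w l) x - Du x)‖ₑ := by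
                congr 1; abel
            _ ≤ _ := enorm_sub_le
      _ = (∫⁻ x, ‖fderiv ℝ (w (l + 1)) x - Du x‖ₑ) + ∫⁻ x, ‖fderiv ℝ (w l) x - Du x‖ₑ :=
          lintegral_add_left'
            ((hDc _).aestronglyMeasurable.sub hu.integrable.aestronglyMeasurable).enorm _
      _ ≤ 8⁻¹ ^ (l + 1) + 8⁻¹ ^ l := add_le_add (hJD _) (hJD _)
      _ ≤ 8⁻¹ ^ l + 8⁻¹ ^ l := add_le_add (pow_le_pow_of_le_one zero_le
          (ENNReal.inv_le_one.2 (by norm_num)) (Nat.le_succ l)) le_rfl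
      _ = _ := by ring
  have h2l : ∀ l : ℕ, ((2⁻¹ : ℝ≥0∞) ^ l)⁻¹ * 8⁻¹ ^ l = 4⁻¹ ^ l := fun l => by
    rw [← ENNReal.inv_pow, inv_inv, ← mul_pow]
    congr 1
    rw [show (8 : ℝ≥0∞) = 2 * 4 by norm_num, ENNReal.mul_inv (by simp) (by simp), ← mul_assoc,
      ENNReal.mul_inv_cancel (by simp) (by simp), one_mul]
  have h2ne : ∀ l : ℕ, ((2⁻¹ : ℝ≥0∞) ^ l) ≠ 0 := fun l => (ENNReal.pow_pos (by simp) l).ne'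
  have h2top : ∀ l : ℕ, ((2⁻¹ : ℝ≥0∞) ^ l) ≠ ∞ := fun l => ENNReal.pow_ne_top (by simp)
  set B : ℕ → Set E := fun l => {x | ∃ ρ, 0 < ρ ∧ ρ ≤ 1 ∧
    2⁻¹ ^ l * volume (closedBall x ρ) < ∫⁻ z in closedBall x ρ, ‖fderiv ℝ (v l) z‖ₑ}
  set G : ℕ → Set E := fun l => {x | (2⁻¹ : ℝ≥0∞) ^ l ≤ ‖fderiv ℝ (w l) x - Du x‖ₑ}
  have hB : ∀ l, volume (B l) ≤ 4 ^ d * 2 * 4⁻¹ ^ l := fun l => by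
    refine (measure_maximal_le volume _ (h2ne l) (h2top l)).trans ?_
    calc _ ≤ 4 ^ d * ((2⁻¹ : ℝ≥0∞) ^ l)⁻¹ * (2 * 8⁻¹ ^ l) := by gcongr; exact hDv l
      _ = 4 ^ d * 2 * (((2⁻¹ : ℝ≥0∞) ^ l)⁻¹ * 8⁻¹ ^ l) := by ring
      _ = _ := by rw [h2l]
  have hG : ∀ l, volume (G l) ≤ 4⁻¹ ^ l := fun l => by
    have h1 := mul_meas_ge_le_lintegral₀ (μ := volume)
      ((hDc l).aestronglyMeasurable.sub hu.integrable.aestronglyMeasurable).enorm (2⁻¹ ^ l)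
    calc volume (G l) = (2⁻¹ ^ l)⁻¹ * (2⁻¹ ^ l * volume (G l)) := by
          rw [← mul_assoc, ENNReal.inv_mul_cancel (h2ne l) (h2top l), one_mul]
      _ ≤ (2⁻¹ ^ l)⁻¹ * 8⁻¹ ^ l := by gcongr; exact h1.trans (hJD l)
      _ = _ := h2l l
  set T : ℕ → Set E := fun l => toMeasurable volume (B l ∪ G l)
  have hT : ∀ l, volume (T l) ≤ (4 ^ d * 2 + 1) * 4⁻¹ ^ l := fun l => by
    rw [measure_toMeasurable]
    calc _ ≤ volume (B l) + volume (G l) := measure_union_le _ _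
      _ ≤ 4 ^ d * 2 * 4⁻¹ ^ l + 4⁻¹ ^ l := add_le_add (hB l) (hG l)
      _ = _ := by ring
  have hsum : ∑' l, volume {x | x ∈ T l} ≠ ∞ := by
    refine ne_top_of_le_ne_top ?_ (ENNReal.tsum_le_tsum hT)
    rw [ENNReal.tsum_mul_left, ENNReal.tsum_geometric]
    refine ENNReal.mul_ne_top (by finiteness) ?_
    rw [ENNReal.inv_ne_top]
    exact (tsub_pos_of_lt (by simp [ENNReal.inv_lt_one])).ne'
  refine ⟨fun j => ⋂ l ≥ j, (T l)ᶜ, fun j => MeasurableSet.iInter fun l => MeasurableSet.iInter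
    fun _ => (measurableSet_toMeasurable _ _).compl, ?_, fun j x hx => ?_⟩
  · refine measure_mono_null (fun x hx => ?_) (measure_setOfPred_frequently_eq_zero hsum)
    rw [mem_ofPred_eq, frequently_atTop]
    intro j
    by_contra! hcon
    exact hx (mem_iUnion.2 ⟨j, by simpa using hcon⟩)
  · have hgood : ∀ l ≥ j, ∀ y ∈ (⋂ l ≥ j, (T l)ᶜ), y ∉ B l ∧ y ∉ G l := fun l hl y hy => by
      have h1 : y ∉ T l := by
        have := mem_iInter₂.1 hy l hl
        exact this
      have h2 : y ∉ B l ∪ G l := fun h => h1 (subset_toMeasurable _ _ h)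
      exact ⟨fun h => h2 (Or.inl h), fun h => h2 (Or.inr h)⟩
    have hcast : ∀ l : ℕ, (2⁻¹ : ℝ≥0∞) ^ l = ENNReal.ofReal ((1 / 2) ^ l) := fun l => by
      rw [ENNReal.ofReal_pow (by norm_num), one_div, ENNReal.ofReal_inv_of_pos two_pos]
      simp
    refine hasFDerivWithinAt_of_geometric (M := 2 ^ (d + 1)) (j := j)
      (fun l => (hw1 l).differentiable one_ne_zero) hwu (fun l hl a ha b hb hab => ?_)
      (fun l hl a ha => ?_) hx
    · have hmax : ∀ y ∈ (⋂ l ≥ j, (T l)ᶜ), ∀ ρ, 0 < ρ → ρ ≤ 1 →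
          ∫⁻ z in closedBall y ρ, ‖fderiv ℝ (v l) z‖ₑ ≤ 2⁻¹ ^ l * volume (closedBall y ρ) :=
        fun y hy ρ h0 h1 => by
          by_contra! hcon
          exact (hgood l hl y hy).1 ⟨ρ, h0, h1, hcon⟩
      have h1 := enorm_sub_le_of_maximal volume (hv1 l) (hmax a ha) (hmax b hb) hab
      rw [hcast, show (2 : ℝ≥0∞) ^ (Module.finrank ℝ E + 1) = ENNReal.ofReal (2 ^ (d + 1)) by
        rw [ENNReal.ofReal_pow zero_le_two]; simp [d], ← ENNReal.ofReal_mul (by positivity),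
        ← ENNReal.ofReal_mul (by positivity), ← ofReal_norm,
        ENNReal.ofReal_le_ofReal_iff (by positivity)] at h1
      exact h1
    · have h1 : ‖fderiv ℝ (w l) a - Du a‖ₑ < 2⁻¹ ^ l := not_le.1 (hgood l hl a ha).2
      rw [hcast, ← ofReal_norm] at h1
      exact ((ENNReal.ofReal_lt_ofReal_iff (by positivity)).1 h1).le

end Differentiability

section Area

theorem lintegral_abs_det_eq_volume_image_of_iUnion {E : Type*} [NormedAddCommGroup E]
    [NormedSpace ℝ E] [FiniteDimensional ℝ E] [MeasurableSpace E] [BorelSpace E] (μ : Measure E)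
    [μ.IsAddHaarMeasure] {u : E → E} {Du : E → E →L[ℝ] E} {A : ℕ → Set E}
    (hA : ∀ j, MeasurableSet (A j)) (hD : ∀ j, ∀ x ∈ A j, HasFDerivWithinAt u (Du x) (A j) x)
    {T : Set E} (hT : MeasurableSet T) (hTA : T ⊆ ⋃ j, A j) (hinj : InjOn u T) :
    ∫⁻ x in T, ENNReal.ofReal |(Du x).det| ∂μ = μ (u '' T) := by
  set S : ℕ → Set E := fun j => T ∩ disjointed A j
  have hSm : ∀ j, MeasurableSet (S j) := fun j => hT.inter (MeasurableSet.disjointed hA j)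
  have hST : ⋃ j, S j = T := by
    rw [← inter_iUnion, iUnion_disjointed, inter_eq_left.2 hTA]
  have hdisj : Pairwise (Function.onFun Disjoint S) := fun i j hij =>
    (disjoint_disjointed A hij).mono inter_subset_right inter_subset_right
  have hSsub : ∀ j, S j ⊆ T := fun j => inter_subset_left
  have hSD : ∀ j, ∀ x ∈ S j, HasFDerivWithinAt u (Du x) (S j) x := fun j x hx =>
    (hD j x (disjointed_subset A j hx.2)).mono
      (inter_subset_right.trans (disjointed_subset A j))
  have hSinj : ∀ j, InjOn u (S j) := fun j => hinj.mono (hSsub j)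
  rw [← hST, lintegral_iUnion hSm hdisj, image_iUnion, measure_iUnion]
  · exact tsum_congr fun j =>
      lintegral_abs_det_fderiv_eq_addHaar_image μ (hSm j) (hSD j) (hSinj j)
  · exact fun i j hij => (hdisj hij).image hinj (hSsub i) (hSsub j)
  · exact fun j => measurable_image_of_fderivWithin (hSm j) (hSD j) (hSinj j)

variable {Ω : Set (Em n)} {u : Em n → Em n} {Du : Em n → Em n →L[ℝ] Em n}

theorem HasWeakDerivOn.exists_hasFDerivWithinAt (hu : HasWeakDerivOn u Du Ω) (hΩ : IsOpen Ω)
    (huc : ContinuousOn u Ω) :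
    ∃ A : ℕ → Set (Em n), (∀ j, MeasurableSet (A j)) ∧ volume (Ω \ ⋃ j, A j) = 0 ∧
      ∀ j, ∀ x ∈ A j, HasFDerivWithinAt u (Du x) (A j) x := by
  have hloc : ∀ c : Ω, ∃ r : ℝ, 0 < r ∧ ∃ A : ℕ → Set (Em n), (∀ j, MeasurableSet (A j)) ∧
      volume (ball (c : Em n) r \ ⋃ j, A j) = 0 ∧
      ∀ j, ∀ x ∈ A j, HasFDerivWithinAt u (Du x) (A j) x := by
    intro c
    obtain ⟨R, hR, hRΩ⟩ := Metric.isOpen_iff.1 hΩ c c.2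
    let χ : ContDiffBump (c : Em n) := ⟨R / 4, R / 2, by positivity, by linarith⟩
    have hχΩ : tsupport χ ⊆ Ω := by
      rw [χ.tsupport_eq]
      exact (closedBall_subset_ball (by change R / 2 < R; linarith)).trans hRΩ
    obtain ⟨A, hA, hA0, hAD⟩ := (hu.smul_cutoff hΩ huc χ.contDiff χ.hasCompactSupport
      hχΩ).exists_hasFDerivWithinAt
    refine ⟨R / 4, by positivity, fun j => A j ∩ ball c (R / 4),
      fun j => (hA j).inter measurableSet_ball, ?_, fun j x hx => ?_⟩
    · refine measure_mono_null (fun x hx => ?_) hA0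
      intro hxA
      obtain ⟨j, hj⟩ := mem_iUnion.1 hxA
      exact hx.2 (mem_iUnion.2 ⟨j, hj, hx.1⟩)
    · have hone : (χ : Em n → ℝ) =ᶠ[𝓝 x] fun _ => 1 := by
        filter_upwards [isOpen_ball.mem_nhds hx.2] with y hy
        exact χ.one_of_mem_closedBall (ball_subset_closedBall hy)
      have h1 := (hAD j x hx.1).mono (inter_subset_left (t := ball (c : Em n) (R / 4)))
      have h2 : χ x • Du x + (fderiv ℝ χ x).smulRight (u x) = Du x := by
        rw [hone.fderiv_eq, hone.eq_of_nhds]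
        ext; simp
      rw [h2] at h1
      refine h1.congr_of_eventuallyEq (mem_nhdsWithin_of_mem_nhds ?_) ?_
      · filter_upwards [hone] with y hy
        simp [hy]
      · simp [hone.eq_of_nhds]
  choose r hr A hA hA0 hAD using hloc
  rcases isEmpty_or_nonempty Ω with hemp | hne
  · refine ⟨fun _ => ∅, fun _ => MeasurableSet.empty, ?_, fun j x hx => hx.elim⟩
    rw [isEmpty_coe_sort.1 hemp]
    simp
  obtain ⟨t, htc, ht⟩ := TopologicalSpace.countable_cover_nhds
    (f := fun c : Ω => (Subtype.val ⁻¹' ball (c : Em n) (r c) : Set Ω))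
    fun c => continuous_subtype_val.continuousAt.preimage_mem_nhds (ball_mem_nhds _ (hr c))
  have htne : t.Nonempty := by
    by_contra hcon
    rw [not_nonempty_iff_eq_empty.1 hcon] at ht
    simp only [biUnion_empty] at ht
    exact (Set.empty_ne_univ ht).elim
  obtain ⟨s, hs⟩ := htc.exists_eq_range htne
  refine ⟨fun m => A (s m.unpair.1) m.unpair.2, fun m => hA _ _, ?_, fun m => hAD _ _⟩
  refine measure_mono_null (fun x hx => ?_)
    (measure_iUnion_null fun i : ℕ => hA0 (s i))
  have h1 : (⟨x, hx.1⟩ : Ω) ∈ ⋃ c ∈ t, (Subtype.val ⁻¹' ball (c : Em n) (r c) : Set Ω) := by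
    rw [ht]; trivial
  obtain ⟨c, hct, hxc⟩ := mem_iUnion₂.1 h1
  rw [hs] at hct
  obtain ⟨i, rfl⟩ := hct
  refine mem_iUnion.2 ⟨i, hxc, fun hxA => ?_⟩
  obtain ⟨j, hj⟩ := mem_iUnion.1 hxA
  exact hx.2 (mem_iUnion.2 ⟨Nat.pair i j, by simpa using hj⟩)

theorem HasWeakDerivOn.exists_area_set (hu : HasWeakDerivOn u Du Ω) (hΩ : IsOpen Ω)
    (huc : ContinuousOn u Ω) (hinj : InjOn u Ω) :
    ∃ S : Set (Em n), MeasurableSet S ∧ volume (Ω \ S) = 0 ∧ ∀ T ⊆ Ω, MeasurableSet T →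
      ∫⁻ x in T, ENNReal.ofReal |(Du x).det| = volume (u '' (T ∩ S)) := by
  obtain ⟨A, hA, hA0, hAD⟩ := hu.exists_hasFDerivWithinAt hΩ huc
  refine ⟨⋃ j, A j, MeasurableSet.iUnion hA, hA0, fun T hTΩ hT => ?_⟩
  rw [← lintegral_abs_det_eq_volume_image_of_iUnion volume hA hAD
    (hT.inter (MeasurableSet.iUnion hA)) inter_subset_right
    (hinj.mono (inter_subset_left.trans hTΩ))]
  refine setLIntegral_congr ?_
  rw [ae_eq_set]
  refine ⟨measure_mono_null ?_ hA0, by simp [sdiff_eq_empty.2 inter_subset_left]⟩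
  rw [sdiff_self_inter]
  exact sdiff_subset_sdiff_left hTΩ

/-- The area inequality for weakly differentiable homeomorphisms. -/
theorem HasWeakDerivOn.lintegral_abs_det_le (hu : HasWeakDerivOn u Du Ω) (hΩ : IsOpen Ω)
    (huc : ContinuousOn u Ω) (hinj : InjOn u Ω) {T : Set (Em n)} (hTΩ : T ⊆ Ω)
    (hT : MeasurableSet T) :
    ∫⁻ x in T, ENNReal.ofReal |(Du x).det| ≤ volume (u '' T) := by
  obtain ⟨S, -, -, hS⟩ := hu.exists_area_set hΩ huc hinj
  rw [hS T hTΩ hT]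
  exact measure_mono (image_mono inter_subset_left)

/-- The area formula for weakly differentiable homeomorphisms satisfying the Lusin condition. -/
theorem HasWeakDerivOn.lintegral_abs_det_eq (hu : HasWeakDerivOn u Du Ω) (hΩ : IsOpen Ω)
    (huc : ContinuousOn u Ω) (hinj : InjOn u Ω) (hN : LusinN u Ω) {T : Set (Em n)} (hTΩ : T ⊆ Ω)
    (hT : MeasurableSet T) :
    ∫⁻ x in T, ENNReal.ofReal |(Du x).det| = volume (u '' T) := by
  refine le_antisymm (hu.lintegral_abs_det_le hΩ huc hinj hTΩ hT) ?_
  obtain ⟨S, -, hS0, hS⟩ := hu.exists_area_set hΩ huc hinj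
  rw [hS T hTΩ hT]
  have hnull : volume (u '' (T \ S)) = 0 :=
    hN _ (sdiff_subset.trans hTΩ) (measure_mono_null (sdiff_subset_sdiff_left hTΩ) hS0)
  calc volume (u '' T) = volume (u '' (T ∩ S) ∪ u '' (T \ S)) := by
        rw [← image_union, inter_union_sdiff]
    _ ≤ volume (u '' (T ∩ S)) + volume (u '' (T \ S)) := measure_union_le _ _
    _ = _ := by rw [hnull, add_zero]

end Area

/-- The linear embedding of `ℝᵈ` onto the coordinate hyperplane `{x | x i = 0}` of `ℝᵈ⁺¹`. -/
def faceIncl {d : ℕ} (i : Fin (d + 1)) : (Fin d → ℝ) →L[ℝ] Em (d + 1) :=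
  LinearMap.toContinuousLinearMap
    { toFun := fun y => WithLp.toLp 2 (i.insertNth (0 : ℝ) y)
      map_add' := fun y z => by
        ext j
        refine Fin.succAboveCases i ?_ (fun k => ?_) j <;> simp
      map_smul' := fun a y => by
        ext j
        refine Fin.succAboveCases i ?_ (fun k => ?_) j <;> simp }

/-- The affine embedding of `ℝᵈ` onto the hyperplane `{x | x i = s}` of `ℝᵈ⁺¹`. -/
def faceMap {d : ℕ} (i : Fin (d + 1)) (s : ℝ) (y : Fin d → ℝ) : Em (d + 1) :=
  faceIncl i y + EuclideanSpace.single i s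

theorem faceMap_eq {d : ℕ} (i : Fin (d + 1)) (s : ℝ) (y : Fin d → ℝ) :
    faceMap i s y = WithLp.toLp 2 (i.insertNth s y) := by
  ext j
  refine Fin.succAboveCases i ?_ (fun k => ?_) j <;> simp [faceMap, faceIncl]

theorem faceMap_removeNth {d : ℕ} (i : Fin (d + 1)) (x : Em (d + 1)) :
    faceMap i (x i) (i.removeNth x) = x := by
  rw [faceMap_eq]
  ext j
  refine Fin.succAboveCases i ?_ (fun k => ?_) j <;> simp [Fin.removeNth]

theorem continuous_faceMap {d : ℕ} (i : Fin (d + 1)) :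
    Continuous fun q : ℝ × (Fin d → ℝ) => faceMap i q.1 q.2 := by
  simp_rw [faceMap_eq]
  refine (PiLp.continuous_toLp 2 _).comp (continuous_pi fun j => ?_)
  refine Fin.succAboveCases i ?_ (fun k => ?_) j
  · simpa using continuous_fst
  · simp only [Fin.insertNth_apply_succAbove]
    fun_prop

theorem lintegral_lintegral_faceMap {d : ℕ} (i : Fin (d + 1)) {F : Em (d + 1) → ℝ≥0∞}
    (hF : Measurable F) : ∫⁻ s, ∫⁻ y, F (faceMap i s y) = ∫⁻ x, F x := by
  have hm : Measurable fun q : ℝ × (Fin d → ℝ) => F (faceMap i q.1 q.2) :=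
    hF.comp (continuous_faceMap i).measurable
  have h1 := (PiLp.volume_preserving_toLp (Fin (d + 1))).lintegral_comp hF
  have h2 := ((volume_preserving_piFinSuccAbove (fun _ : Fin (d + 1) => ℝ) i).symm _).lintegral_comp
    (hF.comp (WithLp.measurable_toLp 2 _))
  rw [← h1]
  simp only [Function.comp_apply] at h2
  rw [← h2, Measure.volume_eq_prod, lintegral_prod _ ?_]
  · simp only [faceMap_eq]
    rfl
  · have := hm.aemeasurable (μ := (volume : Measure ℝ).prod volume)
    simp only [faceMap_eq] at this
    exact this

theorem lintegral_face_le {d : ℕ} {V : Type*} [NormedAddCommGroup V] [NormedSpace ℝ V]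
    (i : Fin (d + 1)) {p : ℝ} (hp : 0 ≤ p) {U : Em (d + 1) → V} (hU : ContDiff ℝ 1 U) (s : ℝ)
    (Q : Set (Fin d → ℝ)) :
    ∫⁻ y in Q, (‖U (faceMap i s y)‖ₑ ^ p + ‖fderiv ℝ (fun z => U (faceMap i s z)) y‖ₑ ^ p) ≤
      (1 + ‖(faceIncl i : (Fin d → ℝ) →L[ℝ] Em (d + 1))‖ₑ ^ p) *
        ∫⁻ y, (‖U (faceMap i s y)‖ₑ ^ p + ‖fderiv ℝ U (faceMap i s y)‖ₑ ^ p) := by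
  rw [← lintegral_const_mul' _ _ (by simp [hp])]
  refine (setLIntegral_le_lintegral _ _).trans (lintegral_mono fun y => ?_)
  have hd : HasFDerivAt (fun z => U (faceMap i s z))
      ((fderiv ℝ U (faceMap i s y)).comp (faceIncl i)) y :=
    ((hU.differentiable one_ne_zero _).hasFDerivAt).comp y
      ((faceIncl i).hasFDerivAt.add_const _)
  rw [hd.fderiv, mul_add]
  refine add_le_add (le_mul_of_one_le_left zero_le le_self_add) ?_
  calc _ ≤ (‖fderiv ℝ U (faceMap i s y)‖ₑ * ‖(faceIncl i : (Fin d → ℝ) →L[ℝ] _)‖ₑ) ^ p := by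
        gcongr
        exact ContinuousLinearMap.opENorm_comp_le _ _
    _ = ‖(faceIncl i : (Fin d → ℝ) →L[ℝ] _)‖ₑ ^ p * ‖fderiv ℝ U (faceMap i s y)‖ₑ ^ p := by
        rw [ENNReal.mul_rpow_of_nonneg _ _ hp, mul_comm]
    _ ≤ _ := mul_le_mul_left le_add_self _

/-- The boundary of the cube with centre `c` and half side `t`. -/
def cubeBoundary (c : Em n) (t : ℝ) : Set (Em n) :=
  {x | (∀ j, |x j - c j| ≤ t) ∧ ∃ i, |x i - c i| = t}

/-- A Morrey inequality on cubes of half side `r` in `ℝᵈ`. -/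
def MorreyOnCubes (d : ℕ) (V : Type*) [NormedAddCommGroup V] [NormedSpace ℝ V] (p r : ℝ) : Prop :=
  ∀ c : Fin d → ℝ, ∃ C : ℝ≥0∞, C ≠ ∞ ∧ ∀ v : (Fin d → ℝ) → V, ContDiff ℝ 1 v →
    ∀ x ∈ closedBall c r,
      ‖v x‖ₑ ^ p ≤ C * ∫⁻ z in closedBall c r, (‖v z‖ₑ ^ p + ‖fderiv ℝ v z‖ₑ ^ p)

theorem exists_cubeBoundary_le_of_contDiff {d : ℕ} {V : Type*} [NormedAddCommGroup V]
    [NormedSpace ℝ V] {p R : ℝ} (hp : 0 ≤ p) (hR : 0 < R) (hM : MorreyOnCubes d V p (2 * R))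
    (c : Em (d + 1)) :
    ∃ C : ℝ≥0∞, C ≠ ∞ ∧ ∀ U : Em (d + 1) → V, ContDiff ℝ 1 U → ∃ t ∈ Icc R (2 * R),
      ∀ x ∈ cubeBoundary c t, ‖U x‖ₑ ^ p ≤ C * ∫⁻ z, (‖U z‖ₑ ^ p + ‖fderiv ℝ U z‖ₑ ^ p) := by
  choose M hMtop hM using fun i : Fin (d + 1) => hM (i.removeNth c)
  set A : Fin (d + 1) → ℝ≥0∞ :=
    fun i => 1 + ‖(faceIncl i : (Fin d → ℝ) →L[ℝ] Em (d + 1))‖ₑ ^ p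
  have hA : ∀ i, A i ≠ ∞ := fun i => by simp [A, hp]
  refine ⟨(∑ i, M i * A i) * ((ENNReal.ofReal R)⁻¹ * (2 * (d + 1))), ?_, fun U hU => ?_⟩
  · refine ENNReal.mul_ne_top (ENNReal.sum_ne_top.2 fun i _ =>
      ENNReal.mul_ne_top (hMtop i) (hA i)) (ENNReal.mul_ne_top (by simpa using hR) ?_)
    exact ENNReal.mul_ne_top (by simp) (by simp)
  set F : Em (d + 1) → ℝ≥0∞ := fun z => ‖U z‖ₑ ^ p + ‖fderiv ℝ U z‖ₑ ^ p
  have hFm : Measurable F :=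
    ((hU.continuous.enorm.measurable).pow_const p).add
      (((hU.continuous_fderiv one_ne_zero).enorm.measurable).pow_const p)
  set Φ : Fin (d + 1) → ℝ → ℝ≥0∞ := fun i s => ∫⁻ y, F (faceMap i s y)
  have hΦm : ∀ i, Measurable (Φ i) := fun i =>
    (hFm.comp (continuous_faceMap i).measurable).lintegral_prod_right'
  have hΦ : ∀ i, ∫⁻ s, Φ i s = ∫⁻ x, F x := fun i => lintegral_lintegral_faceMap i hFm
  set Ψ : ℝ → ℝ≥0∞ := fun t => ∑ i, (Φ i (c i + t) + Φ i (c i - t))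
  have hΨm : Measurable Ψ := Finset.measurable_sum _ fun i _ =>
    ((hΦm i).comp (measurable_const_add _)).add ((hΦm i).comp (measurable_const.sub measurable_id))
  have hΨ : ∫⁻ t, Ψ t = 2 * (d + 1) * ∫⁻ x, F x := by
    have hsum : ∫⁻ t, Ψ t = ∑ i, ∫⁻ t, (Φ i (c i + t) + Φ i (c i - t)) :=
      lintegral_finsetSum _ fun i _ => ((hΦm i).comp (measurable_const_add _)).add
        ((hΦm i).comp (measurable_const.sub measurable_id))
    rw [hsum]
    have : ∀ i, ∫⁻ t, (Φ i (c i + t) + Φ i (c i - t)) = 2 * ∫⁻ x, F x := fun i => by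
      have hm : Measurable fun t => Φ i (c i + t) := (hΦm i).comp (measurable_const_add _)
      rw [lintegral_add_left hm,
        lintegral_add_left_eq_self (fun t => Φ i t), lintegral_sub_left_eq_self (fun t => Φ i t),
        hΦ, two_mul]
    simp only [this, Finset.sum_const, Finset.card_univ, Fintype.card_fin, nsmul_eq_mul]
    push_cast
    ring
  have hvol : volume (Icc R (2 * R)) = ENNReal.ofReal R := by
    rw [Real.volume_Icc]; congr 1; ring
  obtain ⟨t, ht, hle⟩ := exists_le_setLAverage (μ := volume) (s := Icc R (2 * R)) (f := Ψ)
    (by rw [hvol]; simpa using hR) (by rw [hvol]; simp) hΨm.aemeasurable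
  refine ⟨t, ht, fun x hx => ?_⟩
  rw [setLAverage_eq, hvol] at hle
  have hle' : Ψ t ≤ (ENNReal.ofReal R)⁻¹ * (2 * (d + 1)) * ∫⁻ z, F z := by
    refine hle.trans ?_
    rw [ENNReal.div_eq_inv_mul, mul_assoc]
    refine mul_le_mul_right ?_ _
    exact (setLIntegral_le_lintegral _ _).trans hΨ.le
  obtain ⟨hxj, i, hi⟩ := hx
  have hΦle : Φ i (x i) ≤ Ψ t := by
    refine le_trans ?_ (Finset.single_le_sum (f := fun i => Φ i (c i + t) + Φ i (c i - t))
      (fun _ _ => zero_le) (Finset.mem_univ i))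
    rcases abs_eq (hR.le.trans ht.1) |>.1 hi with h | h
    · rw [show x i = c i + t by linarith]; exact le_self_add
    · rw [show x i = c i - t by linarith]; exact le_add_self
  have hmem : i.removeNth x ∈ closedBall (i.removeNth c) (2 * R) := by
    rw [mem_closedBall, dist_pi_le_iff (by positivity)]
    intro j
    rw [Real.dist_eq]
    exact (hxj _).trans ht.2
  have hsm : ContDiff ℝ 1 fun y : Fin d → ℝ => U (faceMap i (x i) y) :=
    hU.comp ((faceIncl i).contDiff.add contDiff_const)
  have key := hM i _ hsm _ hmem
  simp only [faceMap_removeNth] at key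
  calc ‖U x‖ₑ ^ p ≤ M i * (A i * Φ i (x i)) :=
        key.trans (mul_le_mul_right (lintegral_face_le i hp hU _ _) _)
    _ ≤ M i * (A i * ((ENNReal.ofReal R)⁻¹ * (2 * (d + 1)) * ∫⁻ z, F z)) := by
        gcongr; exact hΦle.trans hle'
    _ = M i * A i * ((ENNReal.ofReal R)⁻¹ * (2 * (d + 1)) * ∫⁻ z, F z) := by ring
    _ ≤ (∑ i, M i * A i) * ((ENNReal.ofReal R)⁻¹ * (2 * (d + 1)) * ∫⁻ z, F z) := by
        gcongr
        exact Finset.single_le_sum (f := fun i => M i * A i) (fun _ _ => zero_le)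
          (Finset.mem_univ i)
    _ = _ := by ring

theorem HasWeakFDeriv.exists_cubeBoundary_le {d : ℕ} {V : Type*} [NormedAddCommGroup V]
    [NormedSpace ℝ V] [CompleteSpace V] {p R : ℝ} (hp : 1 ≤ p) (hR : 0 < R)
    (hM : MorreyOnCubes d V p (2 * R)) (c : Em (d + 1)) :
    ∃ C : ℝ≥0∞, C ≠ ∞ ∧ ∀ (u : Em (d + 1) → V) (Du : Em (d + 1) → Em (d + 1) →L[ℝ] V),
      HasWeakFDeriv u Du → ∃ t ∈ Icc R (2 * R), ∀ x ∈ cubeBoundary c t,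
        ‖u x‖ₑ ^ p ≤ C * ((∫⁻ z, ‖u z‖ₑ ^ p) + ∫⁻ z, ‖Du z‖ₑ ^ p) := by
  obtain ⟨C, hC, h⟩ := exists_cubeBoundary_le_of_contDiff (by linarith) hR hM c
  refine ⟨C, hC, fun u Du hu => ?_⟩
  obtain ⟨U, hU1, hUu, hUp, hDUp, -⟩ := hu.exists_approx
  choose t ht hle using fun j => h (U j) (hU1 j)
  obtain ⟨t₀, ht₀, φ, hφ, hlim⟩ := isCompact_Icc.tendsto_subseq ht
  refine ⟨t₀, ht₀, fun x hx => ?_⟩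
  have ht₀pos : 0 < t₀ := hR.trans_le ht₀.1
  have hpos : ∀ j, 0 < t j := fun j => hR.trans_le (ht j).1
  set X : ℕ → Em (d + 1) := fun j => c + (t (φ j) / t₀) • (x - c)
  have hX : Tendsto X atTop (𝓝 x) := by
    have : Tendsto (fun j => c + (t (φ j) / t₀) • (x - c)) atTop (𝓝 (c + (t₀ / t₀) • (x - c))) :=
      ((hlim.div_const t₀).smul_const _).const_add c
    rwa [div_self ht₀pos.ne', one_smul, add_sub_cancel] at this
  have hXmem : ∀ j, X j ∈ cubeBoundary c (t (φ j)) := fun j => by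
    have hcoord : ∀ k, |X j k - c k| = t (φ j) / t₀ * |x k - c k| := fun k => by
      simp only [X, PiLp.add_apply, PiLp.smul_apply, PiLp.sub_apply, smul_eq_mul,
        add_sub_cancel_left, abs_mul, abs_of_pos (div_pos (hpos (φ j)) ht₀pos)]
    refine ⟨fun k => ?_, hx.2.imp fun k hk => ?_⟩
    · rw [hcoord, div_mul_eq_mul_div, div_le_iff₀ ht₀pos]
      exact mul_le_mul_of_nonneg_left (hx.1 k) (hpos _).le
    · rw [hcoord, hk, div_mul_cancel₀ _ ht₀pos.ne']
  have hUX : Tendsto (fun j => U (φ j) (X j)) atTop (𝓝 (u x)) :=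
    TendstoUniformly.tendsto_comp (F := fun j => U (φ j))
      (fun s hs => hφ.tendsto_atTop.eventually (hUu s hs)) hu.continuous.continuousAt hX
  have hUX' : Tendsto (fun j => ‖U (φ j) (X j)‖ₑ ^ p) atTop (𝓝 (‖u x‖ₑ ^ p)) :=
    (ENNReal.continuous_rpow_const.tendsto _).comp hUX.enorm
  refine le_of_tendsto' hUX' fun j => (hle _ _ (hXmem j)).trans (mul_le_mul_right ?_ _)
  rw [lintegral_add_left ((hU1 _).continuous.enorm.measurable.pow_const p)]
  exact add_le_add (hUp _ p hp) (hDUp _ p hp)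

theorem morreyOnCubes {d : ℕ} (hd : 2 ≤ d + 1) {p : ℝ}
    (hp : (3 ≤ d + 1 → ((d + 1 : ℕ) : ℝ) - 1 < p) ∧ (d + 1 = 2 → 1 ≤ p)) (V : Type*)
    [NormedAddCommGroup V] [NormedSpace ℝ V] [CompleteSpace V] {r : ℝ} (hr : 0 < r) :
    MorreyOnCubes d V p r := by
  intro c
  rcases Nat.lt_or_ge 2 (d + 1) with h3 | h2
  · have hlt := hp.1 h3
    push_cast at hlt
    have hd1 : (1 : ℝ) ≤ d := by exact_mod_cast (by omega : 1 ≤ d)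
    exact exists_morrey volume (convex_closedBall c r) measurableSet_closedBall
      isBounded_closedBall (measure_closedBall_pos volume c hr).ne' (by linarith)
      (by simp only [Module.finrank_fintype_fun_eq_card, Fintype.card_fin]; linarith)
  · obtain rfl : d = 1 := by omega
    exact exists_morrey_fin_one c hr (hp.2 rfl)

theorem one_le_exponent (hn : 2 ≤ n) {p : ℝ}
    (hp : (3 ≤ n → (n : ℝ) - 1 < p) ∧ (n = 2 → 1 ≤ p)) : 1 ≤ p := by
  rcases Nat.lt_or_ge 2 n with h3 | h2
  · have := hp.1 h3
    have hn3 : (3 : ℝ) ≤ n := by exact_mod_cast h3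
    linarith
  · exact hp.2 (by omega)

/-- Multiplying by a cutoff function `χ` is bounded in `W^{1,p}`, pointwise. -/
theorem enorm_cutoff_rpow_add_le {E V : Type*} [NormedAddCommGroup E] [NormedSpace ℝ E]
    [NormedAddCommGroup V] [NormedSpace ℝ V] {p : ℝ} (hp : 1 ≤ p) {M : ℝ≥0∞} {a : ℝ}
    {L : E →L[ℝ] ℝ} (ha : ‖a‖ₑ ≤ M) (hL : ‖L‖ₑ ≤ M) (v : V) (A : E →L[ℝ] V) :
    ‖a • v‖ₑ ^ p + ‖a • A + L.smulRight v‖ₑ ^ p ≤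
      M ^ p * (1 + 2 ^ (p - 1)) * (‖v‖ₑ ^ p + ‖A‖ₑ ^ p) := by
  have hp0 : 0 ≤ p := by linarith
  have h1 : ‖a • v‖ₑ ≤ M * ‖v‖ₑ := by
    rw [enorm_smul]; gcongr
  have h2 : ‖a • A + L.smulRight v‖ₑ ≤ M * ‖v‖ₑ + M * ‖A‖ₑ := by
    rw [add_comm (M * _)]
    refine (enorm_add_le (a • A) (L.smulRight v)).trans (add_le_add ?_ ?_)
    · rw [enorm_smul]; gcongr
    · rw [← ofReal_norm, ContinuousLinearMap.norm_smulRight_apply,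
        ENNReal.ofReal_mul (norm_nonneg _), ofReal_norm, ofReal_norm]
      gcongr
  calc _ ≤ (M * ‖v‖ₑ) ^ p + (M * ‖v‖ₑ + M * ‖A‖ₑ) ^ p := by gcongr
    _ ≤ (M * ‖v‖ₑ) ^ p + 2 ^ (p - 1) * ((M * ‖v‖ₑ) ^ p + (M * ‖A‖ₑ) ^ p) := by
        gcongr
        exact ENNReal.rpow_add_le_mul_rpow_add_rpow _ _ hp
    _ ≤ ((M * ‖v‖ₑ) ^ p + (M * ‖A‖ₑ) ^ p) +
        2 ^ (p - 1) * ((M * ‖v‖ₑ) ^ p + (M * ‖A‖ₑ) ^ p) := by gcongr; exact le_self_add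
    _ = _ := by
        rw [ENNReal.mul_rpow_of_nonneg _ _ hp0, ENNReal.mul_rpow_of_nonneg _ _ hp0]
        ring

section Convergence

variable {p : ℝ} {Ω : Set (Em n)} {f : ℕ → Em n → Em n} {Df : ℕ → Em n → Em n →L[ℝ] Em n}
  {g : Em n → Em n} {Dg : Em n → Em n →L[ℝ] Em n}

theorem IsHomeoOnto.continuousOn (hg : IsHomeoOnto g Ω) : ContinuousOn g Ω :=
  continuousOn_iff_continuous_domRestrict.2 hg.continuous

theorem IsHomeoOnto.injOn (hg : IsHomeoOnto g Ω) : InjOn g Ω :=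
  injOn_iff_injective.2 hg.injective

theorem TendstoW1pLocOn.tendsto_cutoff (hconv : TendstoW1pLocOn p f Df g Dg Ω) (hp : 1 ≤ p)
    {χ : Em n → ℝ} (hχ : ContDiff ℝ (⊤ : ℕ∞) χ) (hχc : HasCompactSupport χ)
    (hχΩ : tsupport χ ⊆ Ω) :
    Tendsto (fun k => ∫⁻ x, (‖χ x • (f k x - g x)‖ₑ ^ p +
      ‖χ x • (Df k x - Dg x) + (fderiv ℝ χ x).smulRight (f k x - g x)‖ₑ ^ p)) atTop (𝓝 0) := by
  have hp0 : 0 < p := by linarith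
  have hD : Continuous (fderiv ℝ χ) := hχ.continuous_fderiv (by simp)
  obtain ⟨M₁, hM₁⟩ := hχc.exists_bound_of_continuous hχ.continuous
  obtain ⟨M₂, hM₂⟩ := (hχc.fderiv (𝕜 := ℝ)).exists_bound_of_continuous hD
  set M : ℝ≥0∞ := ENNReal.ofReal (max M₁ M₂)
  have h1 : ∀ x, ‖χ x‖ₑ ≤ M := fun x => by
    rw [← ofReal_norm]; exact ENNReal.ofReal_le_ofReal ((hM₁ x).trans (le_max_left _ _))
  have h2 : ∀ x, ‖fderiv ℝ χ x‖ₑ ≤ M := fun x => by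
    rw [← ofReal_norm]; exact ENNReal.ofReal_le_ofReal ((hM₂ x).trans (le_max_right _ _))
  set A : ℝ≥0∞ := M ^ p * (1 + 2 ^ (p - 1))
  have hA : A ≠ ∞ := ENNReal.mul_ne_top (ENNReal.rpow_ne_top_of_nonneg hp0.le (by simp [M]))
    (ENNReal.add_ne_top.2 ⟨by simp, ENNReal.rpow_ne_top_of_nonneg (by linarith) (by simp)⟩)
  have hlim := ENNReal.Tendsto.const_mul (a := A) (hconv _ hχΩ hχc) (Or.inr hA)
  rw [mul_zero] at hlim
  refine tendsto_of_tendsto_of_tendsto_of_le_of_le tendsto_const_nhds hlim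
    (fun _ => zero_le) fun k => ?_
  dsimp only
  rw [← lintegral_const_mul' _ _ hA, ← lintegral_indicator (isClosed_tsupport χ).measurableSet]
  refine lintegral_mono fun x => ?_
  by_cases hx : x ∈ tsupport χ
  · rw [indicator_of_mem hx]
    exact enorm_cutoff_rpow_add_le hp (h1 x) (h2 x) _ _
  · have hx' : fderiv ℝ χ x = 0 := by
      by_contra h
      exact hx (support_fderiv_subset ℝ h)
    have hx0 : χ x = 0 := image_eq_zero_of_notMem_tsupport hx
    refine (enorm_cutoff_rpow_add_le hp (M := 0) (by simp [hx0])
      (by rw [hx', ← ofReal_norm, norm_zero, ENNReal.ofReal_zero]) _ _).trans ?_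
    simp [hp0]

theorem TendstoW1pLocOn.eventually_image_subset_closedBall (hn : 2 ≤ n)
    (hp : (3 ≤ n → (n : ℝ) - 1 < p) ∧ (n = 2 → 1 ≤ p)) (hΩ : IsOpen Ω)
    (hf : ∀ k, IsHomeoOnto (f k) Ω) (hg : IsHomeoOnto g Ω)
    (hfW : ∀ k, HasWeakDerivOn (f k) (Df k) Ω) (hgW : HasWeakDerivOn g Dg Ω)
    (hconv : TendstoW1pLocOn p f Df g Dg Ω) {c : Em n} (hc : c ∈ Ω) {ε : ℝ} (hε : 0 < ε) :
    ∃ S ∈ 𝓝 c, ∀ᶠ k in atTop, ∀ x ∈ S, f k x ∈ closedBall (g c) ε := by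
  have hp1 := one_le_exponent hn hp
  obtain ⟨δ, hδ, hδΩ⟩ : ∃ δ > 0, ball c δ ⊆ Ω ∩ g ⁻¹' ball (g c) (ε / 2) :=
    Metric.mem_nhds_iff.1 (inter_mem (hΩ.mem_nhds hc)
      ((hg.continuousOn.continuousAt (hΩ.mem_nhds hc)).preimage_mem_nhds
        (ball_mem_nhds _ (by positivity))))
  obtain ⟨R, hR, hRδ⟩ : ∃ R > 0, WithLp.toLp 2 '' closedBall c.ofLp (2 * R) ⊆ ball c (δ / 4) := by
    have := (PiLp.continuous_toLp 2 (fun _ : Fin n => ℝ)).continuousAt (x := c.ofLp)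
      |>.preimage_mem_nhds (ball_mem_nhds _ (by positivity : 0 < δ / 4))
    obtain ⟨r, hr, hrs⟩ := Metric.nhds_basis_closedBall.mem_iff.1 this
    refine ⟨r / 2, by positivity, ?_⟩
    rw [mul_div_cancel₀ _ two_ne_zero]
    exact image_subset_iff.2 hrs
  let χ : ContDiffBump c := ⟨δ / 4, δ / 2, by positivity, by linarith⟩
  have hχΩ : tsupport χ ⊆ Ω := by
    rw [χ.tsupport_eq]
    exact (closedBall_subset_ball (by change δ / 2 < δ; linarith)).trans
      (hδΩ.trans inter_subset_left)
  have hχ1 : ∀ x ∈ ball c (δ / 4), χ x = 1 := fun x hx =>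
    χ.one_of_mem_closedBall (ball_subset_closedBall hx)
  have hweak : ∀ k, HasWeakFDeriv (fun x => χ x • (f k x - g x))
      (fun x => χ x • (Df k x - Dg x) + (fderiv ℝ χ x).smulRight (f k x - g x)) := fun k => by
    have := ((hfW k).smul_cutoff hΩ (hf k).continuousOn χ.contDiff χ.hasCompactSupport hχΩ).sub
      (hgW.smul_cutoff hΩ hg.continuousOn χ.contDiff χ.hasCompactSupport hχΩ)
    convert this using 2 with x x
    · rw [smul_sub]
    · ext v : 1
      simp only [_root_.add_apply, _root_.sub_apply, _root_.smul_apply,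
        ContinuousLinearMap.smulRight_apply, smul_sub]
      abel
  have hlim := hconv.tendsto_cutoff hp1 χ.contDiff χ.hasCompactSupport hχΩ
  obtain ⟨d, rfl⟩ : ∃ d, n = d + 1 := ⟨n - 1, by omega⟩
  obtain ⟨C, hC, hCle⟩ := HasWeakFDeriv.exists_cubeBoundary_le (V := Em (d + 1)) hp1 hR
    (morreyOnCubes hn hp _ (by positivity)) c
  have hlim' := ENNReal.Tendsto.const_mul (a := C) hlim (Or.inr hC)
  rw [mul_zero] at hlim'
  have hev := hlim'.eventually_le_const (u := ENNReal.ofReal (ε / 2) ^ p)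
    (ENNReal.rpow_pos (by simpa using hε) (by simp))
  refine ⟨WithLp.ofLp ⁻¹' closedBall c.ofLp R,
    (PiLp.continuous_ofLp 2 _).continuousAt.preimage_mem_nhds (closedBall_mem_nhds _ hR), ?_⟩
  filter_upwards [hev] with k hk x hx
  obtain ⟨t, ht, hbd⟩ := hCle _ _ (hweak k)
  have ht0 : 0 < t := hR.trans_le ht.1
  set Q : Set (Em (d + 1)) := WithLp.toLp 2 '' closedBall c.ofLp t
  have hQδ : Q ⊆ ball c (δ / 4) := (image_mono (closedBall_subset_closedBall ht.2)).trans hRδ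
  have hQΩ : Q ⊆ Ω := hQδ.trans ((ball_subset_ball (by linarith)).trans
    (hδΩ.trans inter_subset_left))
  have hQpre : Q = WithLp.ofLp ⁻¹' closedBall c.ofLp t := by
    ext y
    exact ⟨by rintro ⟨z, hz, rfl⟩; exact hz, fun hy => ⟨y.ofLp, hy, rfl⟩⟩
  refine image_subset_closedBall_of_frontier (s := Q)
    ((isCompact_closedBall _ _).image (PiLp.continuous_toLp 2 _))
    ((hf k).continuousOn.mono hQΩ) ((hf k).injOn.mono hQΩ) (fun y hy hyi => ?_) x
    (hQpre ▸ closedBall_subset_closedBall ht.1 hx)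
  have hyQ : dist y.ofLp c.ofLp ≤ t := by rw [hQpre] at hy; exact hy
  have hycoord : ∀ j, |y j - c j| ≤ t := fun j => (dist_le_pi_dist y.ofLp c.ofLp j).trans hyQ
  have hybd : y ∈ cubeBoundary c t := by
    refine ⟨hycoord, ?_⟩
    by_contra! hne
    refine hyi (mem_interior_iff_mem_nhds.2 ?_)
    rw [hQpre]
    refine (PiLp.continuous_ofLp 2 _).continuousAt.preimage_mem_nhds
      (mem_of_superset (isOpen_ball.mem_nhds ?_) ball_subset_closedBall)
    rw [mem_ball, dist_pi_lt_iff ht0]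
    exact fun j => (hycoord j).lt_of_ne (hne j)
  have hy1 := hbd y hybd
  rw [← lintegral_add_left
    ((hweak k).continuous.enorm.measurable.pow_const p)] at hy1
  have hy2 := (ENNReal.rpow_le_rpow_iff (by linarith)).1 (hy1.trans hk)
  rw [hχ1 y (hQδ hy), one_smul, ← ofReal_norm, ENNReal.ofReal_le_ofReal_iff (by positivity)] at hy2
  have hgy : dist (g y) (g c) < ε / 2 :=
    (hδΩ (ball_subset_ball (by linarith) (hQδ hy))).2
  calc dist (f k y) (g c) ≤ dist (f k y) (g y) + dist (g y) (g c) := dist_triangle _ _ _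
    _ ≤ ε / 2 + ε / 2 := add_le_add (by rwa [dist_eq_norm]) hgy.le
    _ = ε := add_halves ε

theorem TendstoW1pLocOn.eventually_image_subset_cthickening (hn : 2 ≤ n)
    (hp : (3 ≤ n → (n : ℝ) - 1 < p) ∧ (n = 2 → 1 ≤ p)) (hΩ : IsOpen Ω)
    (hf : ∀ k, IsHomeoOnto (f k) Ω) (hg : IsHomeoOnto g Ω)
    (hfW : ∀ k, HasWeakDerivOn (f k) (Df k) Ω) (hgW : HasWeakDerivOn g Dg Ω)
    (hconv : TendstoW1pLocOn p f Df g Dg Ω) {K : Set (Em n)} (hKΩ : K ⊆ Ω) (hK : IsCompact K)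
    {ε : ℝ} (hε : 0 < ε) :
    ∀ᶠ k in atTop, f k '' K ⊆ cthickening ε (g '' K) := by
  choose! S hS hev using fun c (hc : c ∈ K) =>
    hconv.eventually_image_subset_closedBall hn hp hΩ hf hg hfW hgW (hKΩ hc) hε
  obtain ⟨t, htK, hcov⟩ := hK.elim_nhds_subcover S hS
  have hall : ∀ᶠ k in atTop, ∀ c ∈ t, ∀ x ∈ S c, f k x ∈ closedBall (g c) ε :=
    (Finset.eventually_all t).2 fun c hc => hev c (htK c hc)
  filter_upwards [hall] with k hk
  rintro _ ⟨x, hx, rfl⟩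
  obtain ⟨c, hc, hxc⟩ := mem_iUnion₂.1 (hcov hx)
  exact mem_cthickening_of_dist_le _ (g c) _ _ (mem_image_of_mem g (htK c hc)) (hk c hc x hxc)

theorem TendstoW1pLocOn.eventually_volume_image_le (hn : 2 ≤ n)
    (hp : (3 ≤ n → (n : ℝ) - 1 < p) ∧ (n = 2 → 1 ≤ p)) (hΩ : IsOpen Ω)
    (hf : ∀ k, IsHomeoOnto (f k) Ω) (hg : IsHomeoOnto g Ω)
    (hfW : ∀ k, HasWeakDerivOn (f k) (Df k) Ω) (hgW : HasWeakDerivOn g Dg Ω)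
    (hconv : TendstoW1pLocOn p f Df g Dg Ω) {K : Set (Em n)} (hKΩ : K ⊆ Ω) (hK : IsCompact K)
    {ε : ℝ≥0∞} (hε : 0 < ε) :
    ∀ᶠ k in atTop, volume (f k '' K) ≤ volume (g '' K) + ε := by
  have hgK : IsCompact (g '' K) := hK.image_of_continuousOn (hg.continuousOn.mono hKΩ)
  have hlt : volume (g '' K) < volume (g '' K) + ε :=
    ENNReal.lt_add_right hgK.measure_lt_top.ne hε.ne'
  have hth := (tendsto_measure_cthickening_of_isCompact (μ := volume) hgK).eventually_le_const hlt
  obtain ⟨r, hr, hrle⟩ := Metric.eventually_nhds_iff_ball.1 hth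
  have hr2 := hrle (r / 2) (by
    rw [mem_ball_zero_iff, Real.norm_of_nonneg (by positivity)]; linarith)
  filter_upwards [hconv.eventually_image_subset_cthickening hn hp hΩ hf hg hfW hgW hKΩ hK
    (half_pos hr)] with k hk
  exact (measure_mono hk).trans hr2

theorem exists_seq_tendsto_ae_of_tendsto_lintegral_rpow {α W : Type*} [MeasurableSpace α]
    {μ : Measure α} [NormedAddCommGroup W] {F : ℕ → α → W} {G : α → W} (hp : 0 < p)
    (hF : ∀ k, AEStronglyMeasurable (F k) μ) (hG : AEStronglyMeasurable G μ)
    (h : Tendsto (fun k => ∫⁻ x, ‖F k x - G x‖ₑ ^ p ∂μ) atTop (𝓝 0)) :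
    ∃ ns : ℕ → ℕ, StrictMono ns ∧ ∀ᵐ x ∂μ, Tendsto (fun k => F (ns k) x) atTop (𝓝 (G x)) := by
  refine TendstoInMeasure.exists_seq_tendsto_ae
    (tendstoInMeasure_of_tendsto_eLpNorm (p := ENNReal.ofReal p) (by simpa using hp) hF hG ?_)
  have h' := (ENNReal.continuous_rpow_const (y := 1 / p)).tendsto 0 |>.comp h
  rw [ENNReal.zero_rpow_of_pos (by positivity)] at h'
  refine h'.congr fun k => ?_
  rw [eLpNorm_eq_lintegral_rpow_enorm_toReal (by simpa using hp) (by simp),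
    ENNReal.toReal_ofReal hp.le]
  rfl

theorem tendsto_lintegral_enorm_comp_sub {α W : Type*} [MeasurableSpace α] {μ : Measure α}
    [NormedAddCommGroup W] {F : ℕ → α → W} {G : α → W} (hp : 0 < p)
    (hF : ∀ k, AEStronglyMeasurable (F k) μ) (hG : AEStronglyMeasurable G μ)
    (h : Tendsto (fun k => ∫⁻ x, ‖F k x - G x‖ₑ ^ p ∂μ) atTop (𝓝 0)) {J : W → ℝ}
    (hJ : Continuous J) (hfin : ∫⁻ x, ‖J (G x)‖ₑ ∂μ ≠ ∞)
    (hlim : ∀ ε : ℝ≥0∞, 0 < ε →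
      ∀ᶠ k in atTop, ∫⁻ x, ‖J (F k x)‖ₑ ∂μ ≤ ∫⁻ x, ‖J (G x)‖ₑ ∂μ + ε) :
    Tendsto (fun k => ∫⁻ x, ‖J (F k x) - J (G x)‖ₑ ∂μ) atTop (𝓝 0) := by
  refine tendsto_of_subseq_tendsto fun ns hns => ?_
  obtain ⟨ms, hms, hae⟩ := exists_seq_tendsto_ae_of_tendsto_lintegral_rpow hp
    (fun k => hF (ns k)) hG (h.comp hns)
  refine ⟨ms, tendsto_lintegral_enorm_sub_of_ae (a := fun k x => J (F (ns (ms k)) x))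
    (fun k => hJ.comp_aestronglyMeasurable (hF _)) (hJ.comp_aestronglyMeasurable hG) hfin
    (hae.mono fun x hx => (hJ.tendsto _).comp hx) fun ε hε => ?_⟩
  exact (hns.comp hms.tendsto_atTop).eventually (hlim ε hε)

theorem HasWeakDerivOn.aestronglyMeasurable (hgW : HasWeakDerivOn g Dg Ω) {K : Set (Em n)}
    (hKΩ : K ⊆ Ω) (hK : IsCompact K) : AEStronglyMeasurable Dg (volume.restrict K) :=
  (hgW.2.1.integrableOn_compact_subset hKΩ hK).aestronglyMeasurable

theorem TendstoW1pLocOn.tendsto_lintegral_det (hn : 2 ≤ n)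
    (hp : (3 ≤ n → (n : ℝ) - 1 < p) ∧ (n = 2 → 1 ≤ p)) (hΩ : IsOpen Ω)
    (hf : ∀ k, IsHomeoOnto (f k) Ω) (hg : IsHomeoOnto g Ω)
    (hfW : ∀ k, HasWeakDerivOn (f k) (Df k) Ω) (hgW : HasWeakDerivOn g Dg Ω)
    (hconv : TendstoW1pLocOn p f Df g Dg Ω) (hgN : LusinN g Ω) {K : Set (Em n)} (hKΩ : K ⊆ Ω)
    (hK : IsCompact K) :
    Tendsto (fun k => ∫⁻ x in K, ‖(Df k x).det - (Dg x).det‖ₑ) atTop (𝓝 0) := by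
  have hgK : IsCompact (g '' K) := hK.image_of_continuousOn (hg.continuousOn.mono hKΩ)
  have harea := hgW.lintegral_abs_det_eq hΩ hg.continuousOn hg.injOn hgN hKΩ hK.measurableSet
  simp only [← Real.enorm_eq_ofReal_abs] at harea
  refine tendsto_lintegral_enorm_comp_sub (by linarith [one_le_exponent hn hp])
    (fun k => (hfW k).aestronglyMeasurable hKΩ hK) (hgW.aestronglyMeasurable hKΩ hK)
    (tendsto_of_tendsto_of_tendsto_of_le_of_le tendsto_const_nhds (hconv K hKΩ hK)
      (fun _ => zero_le) fun k => lintegral_mono fun x => le_add_self)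
    ContinuousLinearMap.continuous_det (harea ▸ hgK.measure_lt_top.ne) fun ε hε => ?_
  filter_upwards [hconv.eventually_volume_image_le hn hp hΩ hf hg hfW hgW hKΩ hK hε] with k hk
  have hle := (hfW k).lintegral_abs_det_le hΩ (hf k).continuousOn (hf k).injOn hKΩ
    hK.measurableSet
  simp only [← Real.enorm_eq_ofReal_abs] at hle
  rw [harea]
  exact hle.trans hk

theorem eventually_volume_image_ge (hΩ : IsOpen Ω)
    (hf : ∀ k, IsHomeoOnto (f k) Ω) (hg : IsHomeoOnto g Ω)
    (hfW : ∀ k, HasWeakDerivOn (f k) (Df k) Ω) (hgW : HasWeakDerivOn g Dg Ω) (hgN : LusinN g Ω)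
    {K : Set (Em n)} (hKΩ : K ⊆ Ω) (hK : IsCompact K)
    (hdet : Tendsto (fun k => ∫⁻ x in K, ‖(Df k x).det - (Dg x).det‖ₑ) atTop (𝓝 0))
    {E : Set (Em n)} (hEK : E ⊆ K) (hE : MeasurableSet E) {ε : ℝ≥0∞} (hε : 0 < ε) :
    ∀ᶠ k in atTop, volume (g '' E) ≤ volume (f k '' E) + ε := by
  filter_upwards [hdet.eventually_le_const hε] with k hk
  have hgE := hgW.lintegral_abs_det_eq hΩ hg.continuousOn hg.injOn hgN (hEK.trans hKΩ) hE
  have hfE := (hfW k).lintegral_abs_det_le hΩ (hf k).continuousOn (hf k).injOn (hEK.trans hKΩ) hE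
  simp only [← Real.enorm_eq_ofReal_abs] at hgE hfE
  have hm : AEMeasurable (fun x => ‖(Df k x).det‖ₑ) (volume.restrict E) :=
    (ContinuousLinearMap.continuous_det.comp_aestronglyMeasurable
      (((hfW k).aestronglyMeasurable hKΩ hK).mono_set hEK)).enorm
  calc volume (g '' E) = ∫⁻ x in E, ‖(Dg x).det‖ₑ := hgE.symm
    _ ≤ ∫⁻ x in E, (‖(Df k x).det‖ₑ + ‖(Df k x).det - (Dg x).det‖ₑ) := by
        refine lintegral_mono fun x => ?_
        rw [← enorm_neg ((Df k x).det - (Dg x).det)]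
        refine le_trans (le_of_eq ?_) (enorm_add_le _ _)
        congr 1
        ring
    _ = (∫⁻ x in E, ‖(Df k x).det‖ₑ) + ∫⁻ x in E, ‖(Df k x).det - (Dg x).det‖ₑ :=
        lintegral_add_left' hm _
    _ ≤ volume (f k '' E) + ε := add_le_add hfE ((lintegral_mono_set hEK).trans hk)

theorem volume_image_add_volume_image_sdiff {h : Em n → Em n} (hh : IsHomeoOnto h Ω)
    {K E : Set (Em n)} (hKΩ : K ⊆ Ω) (hK : MeasurableSet K) (hEK : E ⊆ K)
    (hE : MeasurableSet E) : volume (h '' E) + volume (h '' (K \ E)) = volume (h '' K) := by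
  rw [← measure_union, ← image_union, union_sdiff_cancel hEK]
  · exact disjoint_sdiff_right.image hh.injOn (hEK.trans hKΩ) (sdiff_subset.trans hKΩ)
  · exact (hK.diff hE).image_of_continuousOn_injOn
      (hh.continuousOn.mono (sdiff_subset.trans hKΩ)) (hh.injOn.mono (sdiff_subset.trans hKΩ))

theorem TendstoW1pLocOn.tendsto_volume_image (hn : 2 ≤ n)
    (hp : (3 ≤ n → (n : ℝ) - 1 < p) ∧ (n = 2 → 1 ≤ p)) (hΩ : IsOpen Ω)
    (hf : ∀ k, IsHomeoOnto (f k) Ω) (hg : IsHomeoOnto g Ω)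
    (hfW : ∀ k, HasWeakDerivOn (f k) (Df k) Ω) (hgW : HasWeakDerivOn g Dg Ω)
    (hconv : TendstoW1pLocOn p f Df g Dg Ω) (hgN : LusinN g Ω) {K E : Set (Em n)} (hKΩ : K ⊆ Ω)
    (hK : IsCompact K) (hEK : E ⊆ K) (hE : MeasurableSet E) :
    Tendsto (fun k => volume (f k '' E)) atTop (𝓝 (volume (g '' E))) := by
  have hdet := hconv.tendsto_lintegral_det hn hp hΩ hf hg hfW hgW hgN hKΩ hK
  have hgK : volume (g '' K) ≠ ∞ :=
    (hK.image_of_continuousOn (hg.continuousOn.mono hKΩ)).measure_lt_top.ne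
  have hfin : ∀ T ⊆ K, volume (g '' T) ≠ ∞ := fun T hT =>
    measure_ne_top_of_subset (image_mono hT) hgK
  refine (ENNReal.tendsto_nhds (hfin E hEK)).2 fun ε hε => ?_
  have hε2 : 0 < ε / 2 := ENNReal.half_pos hε.ne'
  filter_upwards [eventually_volume_image_ge hΩ hf hg hfW hgW hgN hKΩ hK hdet hEK hE hε,
    eventually_volume_image_ge hΩ hf hg hfW hgW hgN hKΩ hK hdet (sdiff_subset (s := K) (t := E))
      (hK.measurableSet.diff hE) hε2,
    hconv.eventually_volume_image_le hn hp hΩ hf hg hfW hgW hKΩ hK hε2] with k h1 h2 h3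
  refine ⟨tsub_le_iff_right.2 h1, ?_⟩
  rw [← volume_image_add_volume_image_sdiff (hf k) hKΩ hK.measurableSet hEK hE,
    ← volume_image_add_volume_image_sdiff hg hKΩ hK.measurableSet hEK hE] at h3
  refine (ENNReal.add_le_add_iff_right (hfin _ (sdiff_subset (s := K) (t := E)))).1 ?_
  calc volume (f k '' E) + volume (g '' (K \ E))
      ≤ volume (f k '' E) + (volume (f k '' (K \ E)) + ε / 2) := by gcongr
    _ = volume (f k '' E) + volume (f k '' (K \ E)) + ε / 2 := (add_assoc _ _ _).symm
    _ ≤ volume (g '' E) + volume (g '' (K \ E)) + ε / 2 + ε / 2 := by gcongr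
    _ = volume (g '' E) + ε + volume (g '' (K \ E)) := by
        rw [add_assoc _ (ε / 2), ENNReal.add_halves, add_right_comm]

end Convergence

theorem stmt11 {n : ℕ} (hn : 2 ≤ n) (p : ℝ)
    (hp : (3 ≤ n → (n : ℝ) - 1 < p) ∧ (n = 2 → 1 ≤ p))
    (Ω : Set (Em n)) (hΩo : IsOpen Ω) (hΩc : IsConnected Ω) (hΩb : Bornology.IsBounded Ω)
    (f : ℕ → Em n → Em n) (Df : ℕ → Em n → Em n →L[ℝ] Em n)
    (g : Em n → Em n) (Dg : Em n → Em n →L[ℝ] Em n)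
    (hf : ∀ k, IsHomeoOnto (f k) Ω)
    (hg : IsHomeoOnto g Ω)
    (hfW : ∀ k, HasWeakDerivOn (f k) (Df k) Ω)
    (hgW : HasWeakDerivOn g Dg Ω)
    (hconv : TendstoW1pLocOn p f Df g Dg Ω)
    (hgN : LusinN g Ω) :
    (∀ E : Set (Em n), MeasurableSet E → closure E ⊆ Ω →
      Tendsto (fun k => volume (f k '' E)) atTop (𝓝 (volume (g '' E)))) ∧
    (∀ K ⊆ Ω, IsCompact K →
      Tendsto (fun k => ∫ x in K, |(Df k x).det - (Dg x).det|) atTop (𝓝 0)) := by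
  refine ⟨fun E hE hEΩ => ?_, fun K hKΩ hK => ?_⟩
  · exact hconv.tendsto_volume_image hn hp hΩo hf hg hfW hgW hgN hEΩ
      ((hΩb.subset (subset_closure.trans hEΩ)).isCompact_closure) subset_closure hE
  · have h := (ENNReal.tendsto_toReal ENNReal.zero_ne_top).comp
      (hconv.tendsto_lintegral_det hn hp hΩo hf hg hfW hgW hgN hKΩ hK)
    rw [ENNReal.toReal_zero] at h
    refine h.congr fun k => ?_
    have hm : AEStronglyMeasurable (fun x => (Df k x).det - (Dg x).det) (volume.restrict K) :=
      (ContinuousLinearMap.continuous_det.comp_aestronglyMeasurable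
        ((hfW k).aestronglyMeasurable hKΩ hK)).sub
        (ContinuousLinearMap.continuous_det.comp_aestronglyMeasurable
          (hgW.aestronglyMeasurable hKΩ hK))
    exact (integral_norm_eq_lintegral_enorm hm).symm
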